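/- Proposition C.2. Fix an integer k ≥ 1 and suppose λ_1(n) = o(1), the sequence γ_n defined by Λ_1(n) = (log n + (k−1) log log n + γ_n)/n satisfies γ_n → −∞, and nΛ_1(n) = Ω(1). Let v_x ≠ v_y be fixed vertices, let D_{x,ℓ} be the event that v_x has class 1 and degree exactly ℓ in H(n), and let E_{xy} be the event that v_x and v_y are adjacent in H(n). Then for every fixed nonnegative integer ℓ, P[D_{x,ℓ} ∩ D_{y,ℓ} ∩ E_{xy}] = o( P[D_{x,ℓ} ∩ D_{y,ℓ} ∩ (not E_{xy})] ) as n → ∞. -/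

import Mathlib

open Finset Filter Real
open scoped Classical

/-- A configuration: class assignment, key rings, channel on/off indicators. -/
abbrev Cfg (n r P : ℕ) := (Fin n → Fin r) × (Fin n → Finset (Fin P)) × (Fin n → Fin n → Bool)

/-- Adjacency in the intersection graph `H(n)`: distinct vertices sharing a key
with the channel between them on. -/
def adj {n r P : ℕ} (ω : Cfg n r P) (x y : Fin n) : Prop :=
  x ≠ y ∧ ((ω.2.1 x) ∩ (ω.2.1 y)).Nonempty ∧ ω.2.2 (min x y) (max x y) = true

/-- Degree of a vertex in `H(n)`. -/
noncomputable def deg {n r P : ℕ} (ω : Cfg n r P) (x : Fin n) : ℕ :=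
  (Finset.univ.filter (fun y => adj ω x y)).card

/-- Probability weight of a configuration: classes are i.i.d. with law `μ`,
key rings uniform over `K`-subsets given the class, channels i.i.d. Bernoulli(`α`). -/
noncomputable def wt {n r P : ℕ} (μ : Fin r → ℝ) (K : Fin r → ℕ) (α : ℝ)
    (ω : Cfg n r P) : ℝ :=
  (∏ x : Fin n, μ (ω.1 x) *
      (if (ω.2.1 x).card = K (ω.1 x) then ((P.choose (K (ω.1 x)) : ℝ))⁻¹ else 0)) *
  ∏ p ∈ Finset.univ.filter (fun p : Fin n × Fin n => p.1 < p.2),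
      (if ω.2.2 p.1 p.2 then α else 1 - α)

/-- Probability of an event under the random graph model. -/
noncomputable def Pr {n r P : ℕ} (μ : Fin r → ℝ) (K : Fin r → ℕ) (α : ℝ)
    (E : Cfg n r P → Prop) : ℝ :=
  ∑ ω : Cfg n r P, if E ω then wt μ K α ω else 0

/-- Key-graph edge probability `p_{ij}` between a class-`i` and a class-`j` node. -/
noncomputable def pEdge {r : ℕ} (Pn : ℕ) (Kn : Fin r → ℕ) (i j : Fin r) : ℝ :=
  1 - ((Pn - Kn i).choose (Kn j) : ℝ) / ((Pn.choose (Kn j) : ℝ))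

/-- Mean key-graph edge probability `λ_i` for a class-`i` node. -/
noncomputable def lam {r : ℕ} (μ : Fin r → ℝ) (Pn : ℕ) (Kn : Fin r → ℕ) (i : Fin r) : ℝ :=
  ∑ j, μ j * pEdge Pn Kn i j


/-- Summing a product weight against a product over an injectively indexed subfamily of
coordinates, each of which has total weight one. -/
lemma sum_prod_mul_prod_comp {I J β : Type*} [Fintype I] [Fintype J] [Fintype β] [DecidableEq J]
    (e : I → J) (he : Function.Injective e) (w : J → β → ℝ) (φ : I → β → ℝ)
    (hw : ∀ i, ∑ c, w (e i) c = 1) :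
    ∑ b : J → β, (∏ j, w j (b j)) * ∏ i, φ i (b (e i)) =
      (∏ j, ∑ c, w j c) * ∏ i, ∑ c, w (e i) c * φ i c := by
  classical
  have collapse : ∀ g : I → J → ℝ, ∏ i, g i (e i) = ∏ j, ∏ i, if e i = j then g i j else 1 := by
    intro g
    rw [Finset.prod_comm]
    simp
  have h1 : ∀ b : J → β, (∏ j, w j (b j)) * ∏ i, φ i (b (e i)) =
      ∏ j, (w j (b j) * ∏ i, if e i = j then φ i (b j) else 1) := by
    intro b
    rw [Finset.prod_mul_distrib, ← collapse (fun i j => φ i (b j))]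
  simp_rw [h1]
  rw [← Fintype.prod_sum (fun j c => w j c * ∏ i, if e i = j then φ i c else 1),
    collapse (fun i j => ∑ c, w j c * φ i c), ← Finset.prod_mul_distrib]
  refine Finset.prod_congr rfl fun j _ => ?_
  by_cases hj : ∃ i, e i = j
  · obtain ⟨i, rfl⟩ := hj
    have key : ∀ g : I → ℝ, (∏ i', if e i' = e i then g i' else 1) = g i := by
      intro g
      simp [he.eq_iff]
    simp_rw [key, hw, one_mul]
  · push Not at hj
    simp [hj]

/-- Weight of a class and key ring for a single vertex. -/
noncomputable def vtxWt {r P : ℕ} (μ : Fin r → ℝ) (K : Fin r → ℕ)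
    (u : Fin r × Finset (Fin P)) : ℝ :=
  μ u.1 * (if u.2.card = K u.1 then ((P.choose (K u.1) : ℝ))⁻¹ else 0)

/-- Indicator that two key rings intersect. -/
noncomputable def hit {P : ℕ} (A R : Finset (Fin P)) : ℝ :=
  if (A ∩ R).Nonempty then 1 else 0

/-- The total weight of the unused channel coordinates. -/
noncomputable def chanMass (n : ℕ) : ℝ :=
  ∏ p : Fin n × Fin n, if p.1 < p.2 then 1 else 2

lemma chanMass_pos (n : ℕ) : 0 < chanMass n :=
  Finset.prod_pos fun p _ => by split_ifs <;> norm_num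

lemma adj_iff_of_ne {n r P : ℕ} (ω : Cfg n r P) {x z : Fin n} (h : z ≠ x) :
    adj ω x z ↔ ((ω.2.1 x) ∩ (ω.2.1 z)).Nonempty ∧ ω.2.2 (min x z) (max x z) = true := by
  simp [adj, h.symm]

lemma sum_chan {n P : ℕ} (α : ℝ) (x y : Fin n) (hxy : x ≠ y) (σ : Fin n → Finset (Fin P))
    (a b a' b' : Fin n → ℝ) :
    ∑ c : Fin n → Fin n → Bool,
      (∏ p ∈ Finset.univ.filter (fun p : Fin n × Fin n => p.1 < p.2),
        (if c p.1 p.2 then α else 1 - α)) *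
      ∏ z ∈ Finset.univ.filter (fun z => z ≠ x ∧ z ≠ y),
        ((if (σ x ∩ σ z).Nonempty ∧ c (min x z) (max x z) = true then a z else b z) *
          (if (σ y ∩ σ z).Nonempty ∧ c (min y z) (max y z) = true then a' z else b' z)) =
    chanMass n * ∏ z ∈ Finset.univ.filter (fun z => z ≠ x ∧ z ≠ y),
      ((b z + α * hit (σ x) (σ z) * (a z - b z)) *
        (b' z + α * hit (σ y) (σ z) * (a' z - b' z))) := by
  classical
  let e : {z : Fin n // z ≠ x ∧ z ≠ y} × Bool → Fin n × Fin n := fun q =>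
    if q.2 then (min x q.1.1, max x q.1.1) else (min y q.1.1, max y q.1.1)
  have he : Function.Injective e := by
    rintro ⟨⟨z, hz, hz'⟩, s⟩ ⟨⟨z2, hz2, hz2'⟩, s2⟩ h
    have aux : ∀ u v u' v' : Fin n, (min u v, max u v) = (min u' v', max u' v') →
        (u = u' ∧ v = v') ∨ (u = v' ∧ v = u') := by
      intro u v u' v' h
      simp only [Prod.mk.injEq] at h
      obtain ⟨h1, h2⟩ := h
      rcases le_total u v with h3 | h3 <;> rcases le_total u' v' with h4 | h4 <;>
        simp only [h3, h4, min_eq_left, min_eq_right, max_eq_left, max_eq_right] at h1 h2 <;>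
        simp [h1, h2]
    cases s <;> cases s2 <;> simp only [e, if_true, if_false, Bool.false_eq_true] at h <;>
      rcases aux _ _ _ _ h with ⟨h1, h2⟩ | ⟨h1, h2⟩ <;> (try exact absurd h2 (by grind)) <;> grind
  let w : Fin n × Fin n → Bool → ℝ := fun p c =>
    if p.1 < p.2 then (if c then α else 1 - α) else 1
  let φ : {z : Fin n // z ≠ x ∧ z ≠ y} × Bool → Bool → ℝ := fun q c =>
    if q.2 then (if (σ x ∩ σ q.1).Nonempty ∧ c = true then a q.1 else b q.1)
    else (if (σ y ∩ σ q.1).Nonempty ∧ c = true then a' q.1 else b' q.1)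
  have hlt : ∀ q, (e q).1 < (e q).2 := by
    rintro ⟨⟨z, hz, hz'⟩, s⟩
    cases s <;> simp [e] <;> grind
  have hw : ∀ q, ∑ c, w (e q) c = 1 := by
    intro q
    simp [w, hlt q]
  have main := sum_prod_mul_prod_comp e he w φ hw
  have hmass : ∏ j, ∑ c, w j c = chanMass n := by
    refine Finset.prod_congr rfl fun p _ => ?_
    by_cases hp : p.1 < p.2 <;> simp [w, hp]
  have sub : ∀ g : Fin n → ℝ, ∏ z ∈ Finset.univ.filter (fun z => z ≠ x ∧ z ≠ y), g z =
      ∏ z : {z : Fin n // z ≠ x ∧ z ≠ y}, g z := by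
    intro g
    exact Finset.prod_subtype _ (by simp) g
  rw [hmass, Fintype.prod_prod_type (fun q => ∑ c, w (e q) c * φ q c)] at main
  rw [sub]
  convert main using 1
  · refine Fintype.sum_equiv (Equiv.curry _ _ _).symm _ _ fun c => ?_
    rw [sub, Finset.prod_filter,
      Fintype.prod_prod_type (fun q => φ q ((Equiv.curry _ _ _).symm c (e q)))]
    simp only [φ, e, w, Equiv.curry_symm_apply, Function.uncurry, Fintype.prod_bool, if_true,
      Bool.false_eq_true, if_false]
  · congr 1
    refine Finset.prod_congr rfl fun z _ => ?_
    have h1 := hlt (z, true)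
    have h2 := hlt (z, false)
    simp only [w, h1, h2, if_true, Fintype.prod_bool, Fintype.sum_bool, φ, hit,
      Bool.false_eq_true, if_false, and_true, and_false]
    congr 1
    · split_ifs <;> ring
    · split_ifs <;> ring

/-- Sum over vertex labels when two distinguished vertices interact with all others. -/
lemma sum_prod_two_pinned {V U : Type*} [Fintype V] [Fintype U] [DecidableEq V]
    (x y : V) (hxy : x ≠ y) (w : U → ℝ) (F : U → U → ℝ) (G : V → U → U → U → ℝ) :
    ∑ s : V → U, (∏ v, w (s v)) * (F (s x) (s y) *
      ∏ z ∈ Finset.univ.filter (fun z => z ≠ x ∧ z ≠ y), G z (s x) (s y) (s z)) =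
    ∑ u, ∑ u', w u * w u' * F u u' *
      ∏ z ∈ Finset.univ.filter (fun z => z ≠ x ∧ z ≠ y), ∑ v, w v * G z u u' v := by
  classical
  have split : ∀ g : V → ℝ, ∏ v, g v =
      g x * g y * ∏ z ∈ Finset.univ.filter (fun z => z ≠ x ∧ z ≠ y), g z := by
    intro g
    have hu : (Finset.univ : Finset V) =
        insert x (insert y (Finset.univ.filter (fun z => z ≠ x ∧ z ≠ y))) := by
      ext z; simp; tauto
    calc ∏ v, g v = ∏ v ∈ insert x (insert y (Finset.univ.filter (fun z => z ≠ x ∧ z ≠ y))), g v := by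
          rw [← hu]
      _ = _ := by
          rw [Finset.prod_insert (by simp [hxy]), Finset.prod_insert (by simp), mul_assoc]
  have step : ∀ u u', w u * w u' * F u u' *
      ∏ z ∈ Finset.univ.filter (fun z => z ≠ x ∧ z ≠ y), ∑ v, w v * G z u u' v =
      ∑ s : V → U, if s x = u ∧ s y = u' then (∏ v, w (s v)) * (F u u' *
      ∏ z ∈ Finset.univ.filter (fun z => z ≠ x ∧ z ≠ y), G z u u' (s z)) else 0 := by
    intro u u'
    let g : V → U → ℝ := fun v c => if v = x then (if c = u then w c else 0) else
      if v = y then (if c = u' then w c else 0) else w c * G v u u' c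
    have hg := Fintype.prod_sum g
    have h1 : ∀ s : V → U, ∏ v, g v (s v) = (if s x = u ∧ s y = u' then (∏ v, w (s v)) * 
      ∏ z ∈ Finset.univ.filter (fun z => z ≠ x ∧ z ≠ y), G z u u' (s z) else 0) := by
      intro s
      rw [split, split (fun v => w (s v))]
      have : ∏ z ∈ Finset.univ.filter (fun z => z ≠ x ∧ z ≠ y), g z (s z) = 
        (∏ z ∈ Finset.univ.filter (fun z => z ≠ x ∧ z ≠ y), w (s z)) *
        ∏ z ∈ Finset.univ.filter (fun z => z ≠ x ∧ z ≠ y), G z u u' (s z) := by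
        rw [← Finset.prod_mul_distrib]
        refine Finset.prod_congr rfl fun z hz => ?_
        simp only [Finset.mem_filter, Finset.mem_univ, true_and] at hz
        simp [g, hz]
      rw [this]
      simp only [g, if_true, hxy.symm, if_false]
      split_ifs <;> simp_all
      ring
    have h2 : ∏ v, ∑ c, g v c = w u * w u' *
        ∏ z ∈ Finset.univ.filter (fun z => z ≠ x ∧ z ≠ y), ∑ v, w v * G z u u' v := by
      rw [split]
      have : ∏ z ∈ Finset.univ.filter (fun z => z ≠ x ∧ z ≠ y), ∑ c, g z c = 
        ∏ z ∈ Finset.univ.filter (fun z => z ≠ x ∧ z ≠ y), ∑ v, w v * G z u u' v := by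
        refine Finset.prod_congr rfl fun z hz => ?_
        simp only [Finset.mem_filter, Finset.mem_univ, true_and] at hz
        simp [g, hz]
      rw [this]
      simp [g, hxy.symm]
    rw [h2] at hg
    simp_rw [h1] at hg
    rw [mul_right_comm, hg, Finset.sum_mul]
    refine Finset.sum_congr rfl fun s _ => ?_
    split_ifs <;> ring
  simp_rw [step]
  have hcomm : ∀ f : U → U → (V → U) → ℝ, ∑ u, ∑ u', ∑ s, f u u' s = ∑ s, ∑ u, ∑ u', f u u' s := by
    intro f
    rw [Finset.sum_comm, Finset.sum_comm]
    rw [Finset.sum_congr rfl fun u _ => Finset.sum_comm]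
    rw [Finset.sum_comm]
  rw [hcomm]
  refine Finset.sum_congr rfl fun s _ => ?_
  simp [ite_and]

/-- Disintegration of the model with respect to the data of two vertices. -/
lemma sum_wt_mul {n r P : ℕ} (μ : Fin r → ℝ) (K : Fin r → ℕ) (α : ℝ) (x y : Fin n)
    (hxy : x ≠ y) (F : Fin r × Finset (Fin P) → Fin r × Finset (Fin P) → ℝ)
    (a b a' b' : Fin n → ℝ) :
    ∑ ω : Cfg n r P, wt μ K α ω * (F (ω.1 x, ω.2.1 x) (ω.1 y, ω.2.1 y) *
      ∏ z ∈ Finset.univ.filter (fun z => z ≠ x ∧ z ≠ y),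
        ((if adj ω x z then a z else b z) * (if adj ω y z then a' z else b' z))) =
    chanMass n * ∑ u : Fin r × Finset (Fin P), ∑ u' : Fin r × Finset (Fin P),
      vtxWt μ K u * vtxWt μ K u' * F u u' *
      ∏ z ∈ Finset.univ.filter (fun z => z ≠ x ∧ z ≠ y), ∑ v : Fin r × Finset (Fin P),
        vtxWt μ K v * ((b z + α * hit u.2 v.2 * (a z - b z)) *
          (b' z + α * hit u'.2 v.2 * (a' z - b' z))) := by
  rw [← sum_prod_two_pinned x y hxy (vtxWt μ K) F (fun z u u' v =>
    ((b z + α * hit u.2 v.2 * (a z - b z)) * (b' z + α * hit u'.2 v.2 * (a' z - b' z)))),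
    Finset.mul_sum]
  have hR : ∀ f : (Fin n → Fin r × Finset (Fin P)) → ℝ, ∑ s, f s =
      ∑ t : Fin n → Fin r, ∑ σ : Fin n → Finset (Fin P), f (fun v => (t v, σ v)) := by
    intro f
    rw [← Fintype.sum_prod_type']
    exact Fintype.sum_equiv (Equiv.arrowProdEquivProdArrow _ _ _) _ _ fun s => rfl
  rw [hR, Fintype.sum_prod_type]
  refine Finset.sum_congr rfl fun t _ => ?_
  rw [Fintype.sum_prod_type]
  refine Finset.sum_congr rfl fun σ _ => ?_
  have := sum_chan α x y hxy σ a b a' b'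
  rw [mul_left_comm, mul_left_comm (chanMass n), ← this, Finset.mul_sum, Finset.mul_sum]
  refine Finset.sum_congr rfl fun c _ => ?_
  have hz : ∏ z ∈ Finset.univ.filter (fun z => z ≠ x ∧ z ≠ y),
        ((if adj (t, σ, c) x z then a z else b z) * (if adj (t, σ, c) y z then a' z else b' z)) =
      ∏ z ∈ Finset.univ.filter (fun z => z ≠ x ∧ z ≠ y),
        ((if (σ x ∩ σ z).Nonempty ∧ c (min x z) (max x z) = true then a z else b z) *
          (if (σ y ∩ σ z).Nonempty ∧ c (min y z) (max y z) = true then a' z else b' z)) := by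
    refine Finset.prod_congr rfl fun z hz => ?_
    simp only [Finset.mem_filter, Finset.mem_univ, true_and] at hz
    simp [adj_iff_of_ne _ hz.1, adj_iff_of_ne _ hz.2]
  rw [hz]
  simp only [wt, vtxWt]
  ring

/-- Uniform law on the `K`-element subsets of `Fin P`. -/
noncomputable def ringWt {P : ℕ} (K : ℕ) (R : Finset (Fin P)) : ℝ :=
  if R.card = K then ((P.choose K : ℝ))⁻¹ else 0

lemma ringWt_nonneg {P : ℕ} (K : ℕ) (R : Finset (Fin P)) : 0 ≤ ringWt K R := by
  unfold ringWt
  split_ifs <;> positivity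

lemma sum_ringWt_ite {P : ℕ} (K : ℕ) (p : Finset (Fin P) → Prop) [DecidablePred p] :
    ∑ R : Finset (Fin P), ringWt K R * (if p R then 1 else 0) =
      (((Finset.univ : Finset (Fin P)).powersetCard K).filter p).card / (P.choose K : ℝ) := by
  have : ∀ R : Finset (Fin P), ringWt K R * (if p R then 1 else 0) =
      if R ∈ ((Finset.univ : Finset (Fin P)).powersetCard K).filter p
      then ((P.choose K : ℝ))⁻¹ else 0 := by
    intro R
    simp only [ringWt, Finset.mem_filter, Finset.mem_powersetCard_univ]
    split_ifs <;> simp_all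
  simp_rw [this]
  rw [Finset.sum_ite_mem, Finset.univ_inter, Finset.sum_const, nsmul_eq_mul, div_eq_mul_inv]

lemma sum_ringWt {P K : ℕ} (hK : K ≤ P) : ∑ R : Finset (Fin P), ringWt K R = 1 := by
  have h := sum_ringWt_ite (P := P) K (fun _ => True)
  have : (P.choose K : ℝ) ≠ 0 := by exact_mod_cast (Nat.choose_pos hK).ne'
  simpa [this] using h

lemma sum_ringWt_disjoint {P : ℕ} (K : ℕ) (A : Finset (Fin P)) :
    ∑ R : Finset (Fin P), ringWt K R * (if (A ∩ R).Nonempty then 0 else 1) =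
      ((P - A.card).choose K : ℝ) / (P.choose K : ℝ) := by
  have h := sum_ringWt_ite (P := P) K (fun R => ¬ (A ∩ R).Nonempty)
  simp only [ite_not] at h
  rw [h]
  congr 2
  have : ((Finset.univ : Finset (Fin P)).powersetCard K).filter (fun R => ¬ (A ∩ R).Nonempty) =
      Aᶜ.powersetCard K := by
    ext R
    simp only [Finset.mem_filter, Finset.mem_powersetCard, Finset.subset_univ, true_and,
      Finset.not_nonempty_iff_eq_empty, ← Finset.disjoint_iff_inter_eq_empty,
      Finset.subset_compl_iff_disjoint_left]
    exact and_comm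
  rw [this, Finset.card_powersetCard, Finset.card_compl, Fintype.card_fin]

lemma choose_sub_sub_le {P K c : ℕ} (hP : 0 < P) (hK : K ≤ P) (hc : c ≤ K) :
    ((P - c).choose (K - c) : ℝ) ≤ ((K : ℝ) / P) ^ c * P.choose K := by
  induction c with
  | zero => simp
  | succ c ih =>
    have ih := ih (by omega)
    obtain ⟨p, hp⟩ : ∃ p, P - c = p + 1 := ⟨P - c - 1, by omega⟩
    obtain ⟨k, hk⟩ : ∃ k, K - c = k + 1 := ⟨K - c - 1, by omega⟩
    have e1 : P - (c + 1) = p := by omega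
    have e2 : K - (c + 1) = k := by omega
    rw [e1, e2]
    rw [hp, hk] at ih
    have h := Nat.add_one_mul_choose_eq p k
    have h' : ((p : ℝ) + 1) * p.choose k = (p + 1).choose (k + 1) * (k + 1) := by exact_mod_cast h
    have hP' : (0 : ℝ) < P := by exact_mod_cast hP
    have hpk : (P : ℝ) * (k + 1) ≤ K * (p + 1) := by
      have h1 : (P : ℝ) = p + 1 + c := by
        have : P = p + 1 + c := by omega
        exact_mod_cast this
      have h2 : (K : ℝ) = k + 1 + c := by
        have : K = k + 1 + c := by omega
        exact_mod_cast this
      have h3 : (K : ℝ) ≤ P := by exact_mod_cast hK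
      have h4 : (0 : ℝ) ≤ c := by positivity
      nlinarith
    calc ((p.choose k : ℕ) : ℝ) = (k + 1) / (p + 1) * (p + 1).choose (k + 1) := by
          field_simp
          linarith
      _ ≤ (K / P) * ((p + 1).choose (k + 1)) := by
          gcongr ?_ * _
          rw [div_le_div_iff₀ (by positivity) hP']
          linarith
      _ ≤ (K / P) * (((K : ℝ) / P) ^ c * P.choose K) := by gcongr
      _ = _ := by ring

lemma sum_ringWt_superset_le {P K : ℕ} (hP : 0 < P) (hK : K ≤ P) (C : Finset (Fin P)) :
    ∑ R : Finset (Fin P), ringWt K R * (if C ⊆ R then 1 else 0) ≤ ((K : ℝ) / P) ^ C.card := by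
  rw [sum_ringWt_ite]
  have hpos : (0 : ℝ) < P.choose K := by exact_mod_cast Nat.choose_pos hK
  rw [div_le_iff₀ hpos]
  by_cases hc : C.card ≤ K
  · rw [Finset.card_filter_powersetCard_subset _ _ _ (Finset.subset_univ _) hc, Finset.card_univ,
      Fintype.card_fin]
    exact choose_sub_sub_le hP hK hc
  · have : ((Finset.univ : Finset (Fin P)).powersetCard K).filter (fun R => C ⊆ R) = ∅ := by
      ext R
      simp only [Finset.mem_filter, Finset.mem_powersetCard_univ, Finset.notMem_empty, iff_false,
        not_and]
      intro h1 h2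
      exact hc (h1 ▸ Finset.card_le_card h2)
    rw [this]
    simp
    positivity

lemma choose_sub_le_exp {P K s : ℕ} (hP : 0 < P) (hs : s ≤ P) :
    ((P - s).choose K : ℝ) ≤ Real.exp (-(s * K / P)) * P.choose K := by
  induction s with
  | zero => simp
  | succ s ih =>
    have ih := ih (by omega)
    obtain ⟨p, hp⟩ : ∃ p, P - s = p + 1 := ⟨P - s - 1, by omega⟩
    have e1 : P - (s + 1) = p := by omega
    rw [e1]
    rw [hp] at ih
    have hP' : (0 : ℝ) < P := by exact_mod_cast hP
    have step : (p.choose K : ℝ) ≤ (1 - K / P) * (p + 1).choose K := by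
      by_cases hKp : K ≤ p + 1
      · have h := Nat.choose_mul_succ_eq p K
        have h' : (p.choose K : ℝ) * (p + 1) = (p + 1).choose K * (p + 1 - K) := by
          have := congrArg (Nat.cast (R := ℝ)) h
          push_cast [Nat.cast_sub hKp] at this
          exact this
        have : (p.choose K : ℝ) = (1 - K / (p + 1)) * (p + 1).choose K := by
          field_simp
          linarith
        rw [this]
        gcongr
        have : p + 1 ≤ P := by omega
        exact_mod_cast this
      · rw [Nat.choose_eq_zero_of_lt (by omega), Nat.choose_eq_zero_of_lt (by omega)]
        simp
    calc (p.choose K : ℝ) ≤ (1 - K / P) * (p + 1).choose K := step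
      _ ≤ Real.exp (-(K / P)) * (p + 1).choose K := by
          gcongr
          exact Real.one_sub_le_exp_neg _
      _ ≤ Real.exp (-(K / P)) * (Real.exp (-(s * K / P)) * P.choose K) := by gcongr
      _ = _ := by
          rw [← mul_assoc, ← Real.exp_add]
          congr 2
          push_cast
          ring

/-- If the probability of an intersection is small, it is comparable to `s K / P`. -/
lemma mul_div_le_of_one_sub_choose_le {P K s : ℕ} (hP : 0 < P) (hK : K ≤ P) (hs : s ≤ P) {p : ℝ}
    (hp : p = 1 - ((P - s).choose K : ℝ) / (P.choose K : ℝ)) (hp5 : p ≤ 1 / 5) :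
    (s * K / P : ℝ) ≤ 5 / 4 * p := by
  have hpos : (0 : ℝ) < P.choose K := by exact_mod_cast Nat.choose_pos hK
  have h1 : 1 - p ≤ Real.exp (-(s * K / P : ℝ)) := by
    rw [hp, sub_sub_cancel, div_le_iff₀ hpos]
    exact choose_sub_le_exp hP hs
  have hx : (0 : ℝ) ≤ s * K / P := by positivity
  set x : ℝ := s * K / P
  have h2 : x + 1 ≤ Real.exp x := Real.add_one_le_exp x
  have h3 : Real.exp x * Real.exp (-x) = 1 := by rw [← Real.exp_add]; simp
  have h4 : (x + 1) * (1 - p) ≤ 1 := by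
    calc (x + 1) * (1 - p) ≤ Real.exp x * Real.exp (-x) := by gcongr; linarith
      _ = 1 := h3
  nlinarith

/-- Moment generating function of the overlap with a uniform ring. -/
lemma sum_ringWt_pow_inter_le {P K : ℕ} (hP : 0 < P) (hK : K ≤ P) (A : Finset (Fin P)) {d : ℝ}
    (hd : 0 ≤ d) :
    ∑ R : Finset (Fin P), ringWt K R * (1 + d) ^ (A ∩ R).card ≤
      Real.exp (d * (A.card * K / P)) := by
  have h1 : ∀ R : Finset (Fin P), (1 + d) ^ (A ∩ R).card =
      ∑ C ∈ A.powerset, d ^ C.card * (if C ⊆ R then 1 else 0) := by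
    intro R
    rw [← Finset.prod_const, Finset.prod_one_add]
    simp_rw [mul_ite, mul_one, mul_zero]
    rw [← Finset.sum_filter]
    have : (A ∩ R).powerset = A.powerset.filter (fun C => C ⊆ R) := by
      ext C
      simp only [Finset.mem_powerset, Finset.mem_filter, Finset.subset_inter_iff]
    rw [this]
    exact Finset.sum_congr rfl fun C _ => Finset.prod_const d
  simp_rw [h1, Finset.mul_sum]
  rw [Finset.sum_comm]
  calc ∑ C ∈ A.powerset, ∑ R, ringWt K R * (d ^ C.card * (if C ⊆ R then 1 else 0))
      = ∑ C ∈ A.powerset, d ^ C.card * ∑ R, ringWt K R * (if C ⊆ R then 1 else 0) := by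
        refine Finset.sum_congr rfl fun C _ => ?_
        rw [Finset.mul_sum]
        exact Finset.sum_congr rfl fun R _ => by ring
    _ ≤ ∑ C ∈ A.powerset, d ^ C.card * ((K : ℝ) / P) ^ C.card := by
        gcongr with C _
        exact sum_ringWt_superset_le hP hK C
    _ = (1 + d * (K / P)) ^ A.card := by
        rw [← Finset.prod_const, Finset.prod_one_add]
        refine Finset.sum_congr rfl fun C _ => ?_
        rw [Finset.prod_const, mul_pow]
    _ ≤ Real.exp (d * (K / P)) ^ A.card := by
        gcongr
        rw [add_comm]
        exact Real.add_one_le_exp _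
    _ = _ := by
        rw [← Real.exp_nat_mul]
        congr 1
        ring

/-- Probability that a uniform ring meets two given rings. -/
lemma sum_ringWt_hit_mul_hit_le {P K : ℕ} (hP : 0 < P) (hK : K ≤ P) (A B : Finset (Fin P)) :
    ∑ R : Finset (Fin P), ringWt K R * (hit A R * hit B R) ≤
      (A ∩ B).card * ((K : ℝ) / P) + (A.card * K / P) * (B.card * K / P) := by
  have h1 : ∀ R : Finset (Fin P), hit A R * hit B R ≤
      ∑ a ∈ A ∩ B, (if {a} ⊆ R then (1 : ℝ) else 0) +
      ∑ a ∈ A, ∑ b ∈ B, if a ≠ b then (if ({a, b} : Finset (Fin P)) ⊆ R then (1 : ℝ) else 0)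
        else 0 := by
    intro R
    have n1 : 0 ≤ ∑ a ∈ A ∩ B, (if {a} ⊆ R then (1 : ℝ) else 0) :=
      Finset.sum_nonneg fun _ _ => by split_ifs <;> norm_num
    have n2 : ∀ a ∈ A, 0 ≤ ∑ b ∈ B, if a ≠ b then
        (if ({a, b} : Finset (Fin P)) ⊆ R then (1 : ℝ) else 0) else 0 :=
      fun a _ => Finset.sum_nonneg fun _ _ => by split_ifs <;> norm_num
    have n3 := Finset.sum_nonneg n2
    unfold hit
    by_cases hA : (A ∩ R).Nonempty
    swap
    · simp only [hA, if_false, zero_mul]; linarith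
    by_cases hB : (B ∩ R).Nonempty
    swap
    · simp only [hB, if_false, mul_zero]; linarith
    simp only [hA, hB, if_true, mul_one]
    obtain ⟨a, ha⟩ := hA
    obtain ⟨b, hb⟩ := hB
    rw [Finset.mem_inter] at ha hb
    by_cases hab : a = b
    · subst hab
      have := Finset.single_le_sum (f := fun a => if {a} ⊆ R then (1 : ℝ) else 0)
        (fun _ _ => by split_ifs <;> norm_num) (Finset.mem_inter.2 ⟨ha.1, hb.1⟩)
      simp only [Finset.singleton_subset_iff, ha.2, if_true] at this n1 ⊢
      linarith
    · have t1 := Finset.single_le_sum n2 ha.1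
      have t2 := Finset.single_le_sum (f := fun b => if a ≠ b then
        (if ({a, b} : Finset (Fin P)) ⊆ R then (1 : ℝ) else 0) else 0)
        (fun _ _ => by split_ifs <;> norm_num) hb.1
      have t3 : ({a, b} : Finset (Fin P)) ⊆ R := by
        simp [Finset.insert_subset_iff, ha.2, hb.2]
      simp only [ne_eq, hab, not_false_eq_true, if_true, t3] at t2
      simp only [ne_eq] at t1 ⊢
      linarith
  calc ∑ R : Finset (Fin P), ringWt K R * (hit A R * hit B R)
      ≤ ∑ R : Finset (Fin P), ringWt K R * (∑ a ∈ A ∩ B, (if {a} ⊆ R then (1 : ℝ) else 0) +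
      ∑ a ∈ A, ∑ b ∈ B, if a ≠ b then (if ({a, b} : Finset (Fin P)) ⊆ R then (1 : ℝ) else 0)
        else 0) := by
        gcongr with R _
        · exact ringWt_nonneg K R
        · exact h1 R
    _ = ∑ a ∈ A ∩ B, ∑ R : Finset (Fin P), ringWt K R * (if {a} ⊆ R then (1 : ℝ) else 0) +
        ∑ a ∈ A, ∑ b ∈ B, ∑ R : Finset (Fin P), ringWt K R * (if a ≠ b then
          (if ({a, b} : Finset (Fin P)) ⊆ R then (1 : ℝ) else 0) else 0) := by
        simp_rw [mul_add, Finset.mul_sum, Finset.sum_add_distrib]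
        congr 1
        · exact Finset.sum_comm
        · rw [Finset.sum_comm]
          exact Finset.sum_congr rfl fun a _ => Finset.sum_comm
    _ ≤ ∑ a ∈ A ∩ B, ((K : ℝ) / P) + ∑ a ∈ A, ∑ b ∈ B, ((K : ℝ) / P) ^ 2 := by
        gcongr with a _ a _ b _
        · simpa using sum_ringWt_superset_le hP hK {a}
        · by_cases hab : a = b
          · simp only [hab, ne_eq, not_true_eq_false, if_false, mul_zero, Finset.sum_const_zero]
            positivity
          · have := sum_ringWt_superset_le hP hK ({a, b} : Finset (Fin P))
            rw [Finset.card_pair hab] at this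
            simpa only [ne_eq, hab, not_false_eq_true, if_true] using this
    _ = _ := by
        simp only [Finset.sum_const, nsmul_eq_mul]
        ring

lemma hit_nonneg {P : ℕ} (A R : Finset (Fin P)) : 0 ≤ hit A R := by
  unfold hit
  split_ifs <;> norm_num

lemma hit_le_one {P : ℕ} (A R : Finset (Fin P)) : hit A R ≤ 1 := by
  unfold hit
  split_ifs <;> norm_num

lemma vtxWt_eq {r P : ℕ} (μ : Fin r → ℝ) (K : Fin r → ℕ) (i : Fin r) (R : Finset (Fin P)) :
    vtxWt μ K (i, R) = μ i * ringWt (K i) R := rfl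

lemma vtxWt_nonneg {r P : ℕ} {μ : Fin r → ℝ} (hμ : ∀ i, 0 < μ i) (K : Fin r → ℕ)
    (u : Fin r × Finset (Fin P)) : 0 ≤ vtxWt μ K u :=
  mul_nonneg (hμ _).le (ringWt_nonneg _ _)

lemma sum_vtxWt_mul {r P : ℕ} (μ : Fin r → ℝ) (K : Fin r → ℕ) (f : Finset (Fin P) → ℝ) :
    ∑ v : Fin r × Finset (Fin P), vtxWt μ K v * f v.2 =
      ∑ j, μ j * ∑ R : Finset (Fin P), ringWt (K j) R * f R := by
  rw [Fintype.sum_prod_type]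
  simp_rw [vtxWt_eq, Finset.mul_sum, mul_assoc]

lemma sum_vtxWt {r P : ℕ} {μ : Fin r → ℝ} {K : Fin r → ℕ} (hμsum : ∑ i, μ i = 1)
    (hK : ∀ i, K i ≤ P) : ∑ v : Fin r × Finset (Fin P), vtxWt μ K v = 1 := by
  have h := sum_vtxWt_mul (P := P) μ K (fun _ => 1)
  simp only [mul_one] at h
  rw [h, ← hμsum]
  exact Finset.sum_congr rfl fun i _ => by rw [sum_ringWt (hK i), mul_one]

lemma sum_ringWt_hit {r P : ℕ} {K : Fin r → ℕ} (hK : ∀ i, K i ≤ P) (i j : Fin r)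
    {A : Finset (Fin P)} (hA : A.card = K i) :
    ∑ R : Finset (Fin P), ringWt (K j) R * hit A R = pEdge P K i j := by
  rw [pEdge, ← hA, ← sum_ringWt_disjoint, eq_sub_iff_add_eq, ← Finset.sum_add_distrib]
  refine (Finset.sum_congr rfl fun R _ => ?_).trans (sum_ringWt (hK j))
  unfold hit
  split_ifs <;> ring

lemma sum_vtxWt_hit {r P : ℕ} {μ : Fin r → ℝ} {K : Fin r → ℕ} (hK : ∀ i, K i ≤ P) (i : Fin r)
    {A : Finset (Fin P)} (hA : A.card = K i) :
    ∑ v : Fin r × Finset (Fin P), vtxWt μ K v * hit A v.2 = lam μ P K i := by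
  rw [sum_vtxWt_mul, lam]
  exact Finset.sum_congr rfl fun j _ => by rw [sum_ringWt_hit hK i j hA]

/-- Probability that the ring of a random vertex meets both given rings. -/
noncomputable def bothHit {r P : ℕ} (μ : Fin r → ℝ) (K : Fin r → ℕ) (A B : Finset (Fin P)) : ℝ :=
  ∑ v : Fin r × Finset (Fin P), vtxWt μ K v * (hit A v.2 * hit B v.2)

lemma bothHit_nonneg {r P : ℕ} {μ : Fin r → ℝ} (hμ : ∀ i, 0 < μ i) (K : Fin r → ℕ)
    (A B : Finset (Fin P)) : 0 ≤ bothHit μ K A B :=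
  Finset.sum_nonneg fun v _ =>
    mul_nonneg (vtxWt_nonneg hμ K v) (mul_nonneg (hit_nonneg _ _) (hit_nonneg _ _))

lemma choose_div_choose_le_one {P K s : ℕ} : ((P - s).choose K : ℝ) / (P.choose K : ℝ) ≤ 1 := by
  apply div_le_one_of_le₀ _ (by positivity)
  exact_mod_cast Nat.choose_le_choose K (Nat.sub_le _ _)

lemma pEdge_nonneg {r P : ℕ} (K : Fin r → ℕ) (i j : Fin r) : 0 ≤ pEdge P K i j :=
  sub_nonneg.2 choose_div_choose_le_one

lemma mul_pEdge_le_lam {r P : ℕ} {μ : Fin r → ℝ} (hμ : ∀ i, 0 < μ i) (K : Fin r → ℕ)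
    (i j : Fin r) : μ j * pEdge P K i j ≤ lam μ P K i :=
  Finset.single_le_sum (f := fun j => μ j * pEdge P K i j)
    (fun j _ => mul_nonneg (hμ j).le (pEdge_nonneg K i j)) (Finset.mem_univ j)

lemma bothHit_le {r P : ℕ} {μ : Fin r → ℝ} (hμ : ∀ i, 0 < μ i) {K : Fin r → ℕ} (hP : 0 < P)
    (hK : ∀ i, K i ≤ P) (i : Fin r) (hKi : 0 < K i) {m : ℝ} (hm : 0 < m) (hmμ : ∀ j, m ≤ μ j)
    (hp5 : ∀ j, pEdge P K i j ≤ 1 / 5) {A B : Finset (Fin P)} (hA : A.card = K i)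
    (hB : B.card = K i) :
    bothHit μ K A B ≤ 5 / 4 * ((A ∩ B).card / K i) * lam μ P K i +
      2 * lam μ P K i ^ 2 / m := by
  have hKi' : (0 : ℝ) < K i := by exact_mod_cast hKi
  have hP' : (0 : ℝ) < P := by exact_mod_cast hP
  have key : ∀ j, ∑ R : Finset (Fin P), ringWt (K j) R * (hit A R * hit B R) ≤
      5 / 4 * ((A ∩ B).card / K i) * pEdge P K i j +
        2 * (pEdge P K i j * lam μ P K i / m) := by
    intro j
    have hx : (K i * K j / P : ℝ) ≤ 5 / 4 * pEdge P K i j :=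
      mul_div_le_of_one_sub_choose_le hP (hK j) (hK i) rfl (hp5 j)
    have hx0 : (0 : ℝ) ≤ K i * K j / P := by positivity
    have hp0 := pEdge_nonneg (P := P) K i j
    have hpl : pEdge P K i j ≤ lam μ P K i / m := by
      rw [le_div_iff₀ hm, mul_comm]
      exact (mul_le_mul_of_nonneg_right (hmμ j) hp0).trans (mul_pEdge_le_lam hμ K i j)
    have h := sum_ringWt_hit_mul_hit_le hP (hK j) A B
    rw [hA, hB] at h
    have e1 : ((A ∩ B).card : ℝ) * ((K j : ℝ) / P) =
        ((A ∩ B).card / K i) * (K i * K j / P) := by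
      field_simp
    have e2 : ((A ∩ B).card / K i : ℝ) * (K i * K j / P) ≤
        ((A ∩ B).card / K i) * (5 / 4 * pEdge P K i j) := by gcongr
    have e3 : (K i * K j / P : ℝ) * (K i * K j / P) ≤ 2 * (pEdge P K i j * lam μ P K i / m) := by
      calc (K i * K j / P : ℝ) * (K i * K j / P)
          ≤ (5 / 4 * pEdge P K i j) * (5 / 4 * pEdge P K i j) := by gcongr
        _ ≤ 2 * (pEdge P K i j * pEdge P K i j) := by nlinarith [mul_nonneg hp0 hp0]
        _ ≤ 2 * (pEdge P K i j * (lam μ P K i / m)) := by gcongr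
        _ = _ := by ring
    linarith
  rw [bothHit, sum_vtxWt_mul μ K (fun R => hit A R * hit B R)]
  calc ∑ j, μ j * ∑ R : Finset (Fin P), ringWt (K j) R * (hit A R * hit B R)
      ≤ ∑ j, μ j * (5 / 4 * ((A ∩ B).card / K i) * pEdge P K i j +
        2 * (pEdge P K i j * lam μ P K i / m)) := by
        gcongr with j _
        · exact (hμ j).le
        · exact key j
    _ = ∑ j, (5 / 4 * ((A ∩ B).card / K i) + 2 * lam μ P K i / m) * (μ j * pEdge P K i j) :=
        Finset.sum_congr rfl fun j _ => by ring
    _ = _ := by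
        rw [← Finset.mul_sum, ← lam]
        ring

lemma sum_vtxWt_two_edges {r P : ℕ} {μ : Fin r → ℝ} {K : Fin r → ℕ} (hμsum : ∑ i, μ i = 1)
    (hK : ∀ i, K i ≤ P) (i : Fin r) {A B : Finset (Fin P)} (hA : A.card = K i)
    (hB : B.card = K i) (α a b a' b' : ℝ) :
    ∑ v : Fin r × Finset (Fin P), vtxWt μ K v *
      ((b + α * hit A v.2 * (a - b)) * (b' + α * hit B v.2 * (a' - b'))) =
    b * b' + (b' * (a - b) + b * (a' - b')) * (α * lam μ P K i) +
      (a - b) * (a' - b') * (α ^ 2 * bothHit μ K A B) := by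
  have h : ∀ v : Fin r × Finset (Fin P), vtxWt μ K v *
      ((b + α * hit A v.2 * (a - b)) * (b' + α * hit B v.2 * (a' - b'))) =
      b * b' * vtxWt μ K v + b' * (a - b) * α * (vtxWt μ K v * hit A v.2) +
      b * (a' - b') * α * (vtxWt μ K v * hit B v.2) +
      (a - b) * (a' - b') * α ^ 2 * (vtxWt μ K v * (hit A v.2 * hit B v.2)) := fun v => by ring
  simp_rw [bothHit, h, Finset.sum_add_distrib, ← Finset.mul_sum, sum_vtxWt hμsum hK,
    sum_vtxWt_hit hK i hA, sum_vtxWt_hit hK i hB]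
  ring

lemma card_filter_ne_ne {n : ℕ} {x y : Fin n} (hxy : x ≠ y) :
    (Finset.univ.filter (fun z => z ≠ x ∧ z ≠ y)).card = n - 2 := by
  have : Finset.univ.filter (fun z => z ≠ x ∧ z ≠ y) = ({x, y} : Finset (Fin n))ᶜ := by
    ext z
    simp
  rw [this, Finset.card_compl, Fintype.card_fin, Finset.card_pair hxy]

lemma wt_nonneg {n r P : ℕ} {μ : Fin r → ℝ} (hμ : ∀ i, 0 < μ i) (K : Fin r → ℕ) {α : ℝ}
    (hα0 : 0 < α) (hα1 : α < 1) (ω : Cfg n r P) : 0 ≤ wt μ K α ω := by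
  refine mul_nonneg (Finset.prod_nonneg fun x _ => ?_) (Finset.prod_nonneg fun p _ => ?_)
  · exact vtxWt_nonneg hμ K (ω.1 x, ω.2.1 x)
  · split_ifs <;> linarith

/-- Sum over pairs of vertex labels of the same class. -/
lemma sum_sum_vtxWt_class {r P : ℕ} (μ : Fin r → ℝ) (K : Fin r → ℕ) (i : Fin r)
    (f : Finset (Fin P) → Finset (Fin P) → ℝ) :
    ∑ u : Fin r × Finset (Fin P), ∑ u' : Fin r × Finset (Fin P),
      vtxWt μ K u * vtxWt μ K u' * (if u.1 = i ∧ u'.1 = i then f u.2 u'.2 else 0) =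
    μ i ^ 2 * ∑ A, ringWt (K i) A * ∑ B, ringWt (K i) B * f A B := by
  simp_rw [Fintype.sum_prod_type, vtxWt_eq]
  rw [Finset.sum_eq_single i _ (by simp)]
  · rw [Finset.mul_sum]
    refine Finset.sum_congr rfl fun A _ => ?_
    rw [Finset.sum_eq_single i _ (by simp)]
    · simp only [and_self, if_true, Finset.mul_sum]
      exact Finset.sum_congr rfl fun B _ => by ring
    · intro j _ hj
      simp [hj]
  · intro j _ hj
    simp [hj]

lemma ringWt_mul_congr {P K : ℕ} {A : Finset (Fin P)} {a b : ℝ} (h : A.card = K → a ≤ b) :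
    ringWt K A * a ≤ ringWt K A * b := by
  by_cases hA : A.card = K
  · exact mul_le_mul_of_nonneg_left (h hA) (ringWt_nonneg _ _)
  · simp [ringWt, hA]

lemma sum_ringWt_hit_mul_pow_le {r P : ℕ} {K : Fin r → ℕ} (hP : 0 < P) (hK : ∀ i, K i ≤ P)
    (i : Fin r) (hp5 : pEdge P K i i ≤ 1 / 5) {d : ℝ} (hd : 0 ≤ d) {A : Finset (Fin P)}
    (hA : A.card = K i) :
    ∑ B, ringWt (K i) B * (hit A B * (1 + d) ^ (A ∩ B).card) ≤
      Real.exp (d * (5 / 4 * pEdge P K i i)) - (1 - pEdge P K i i) := by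
  have h1 : ∑ B, ringWt (K i) B * (hit A B * (1 + d) ^ (A ∩ B).card) =
      ∑ B, ringWt (K i) B * (1 + d) ^ (A ∩ B).card - (1 - pEdge P K i i) := by
    rw [← sum_ringWt_hit hK i i hA, ← sum_ringWt (hK i), ← Finset.sum_sub_distrib,
      ← Finset.sum_sub_distrib]
    refine Finset.sum_congr rfl fun B _ => ?_
    unfold hit
    split_ifs with h
    · ring
    · rw [Finset.not_nonempty_iff_eq_empty] at h
      simp [h]
  rw [h1]
  have h2 := sum_ringWt_pow_inter_le hP (hK i) A hd
  have h3 : (K i * K i / P : ℝ) ≤ 5 / 4 * pEdge P K i i :=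
    mul_div_le_of_one_sub_choose_le hP (hK i) (hK i) rfl hp5
  rw [hA] at h2
  have h4 : Real.exp (d * (K i * K i / P)) ≤ Real.exp (d * (5 / 4 * pEdge P K i i)) := by
    gcongr
  linarith

/-- Upper bound for the joint event with adjacency. -/
lemma Pr_adjacent_le {n r P : ℕ} {μ : Fin r → ℝ} (hμ : ∀ i, 0 < μ i) (hμsum : ∑ i, μ i = 1)
    {K : Fin r → ℕ} (hP : 0 < P) (hK : ∀ i, K i ≤ P) {α : ℝ} (hα0 : 0 < α) (hα1 : α < 1)
    {x y : Fin n} (hxy : x ≠ y) (i : Fin r) (hKi : 0 < K i) {m : ℝ} (hm : 0 < m)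
    (hmμ : ∀ j, m ≤ μ j) (hp5 : ∀ j, pEdge P K i j ≤ 1 / 5) {L : ℝ}
    (hL : L = α * lam μ P K i) {d : ℝ} (hd : 0 ≤ d)
    (hexp : Real.exp (n * α * L * (5 / 4) / K i) ≤ 1 + d) (ℓ : ℕ) :
    Pr μ K α (fun ω : Cfg n r P => ω.1 x = i ∧ deg ω x = ℓ ∧ ω.1 y = i ∧ deg ω y = ℓ ∧
      adj ω x y) ≤
    chanMass n * ((1 + n * L) ^ (2 * ℓ) * Real.exp (-2 * (n * L) + 4 * L + 2 + 2 * (n * L ^ 2) / m)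
      * (μ i ^ 2 * (Real.exp (d * (5 / 4 * pEdge P K i i)) - (1 - pEdge P K i i)))) := by
  have hlam0 : 0 ≤ lam μ P K i :=
    Finset.sum_nonneg fun j _ => mul_nonneg (hμ j).le (pEdge_nonneg K i j)
  have hL0 : 0 ≤ L := hL ▸ mul_nonneg hα0.le hlam0
  have hn2 : 2 ≤ n := by
    have := x.2
    have := y.2
    have : x.1 ≠ y.1 := fun h => hxy (Fin.ext h)
    omega
  have hnL : 0 ≤ n * L := by positivity
  set t : ℝ := 1 / (1 + n * L) with ht
  have ht0 : 0 < t := by positivity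
  have ht1 : t ≤ 1 := by
    rw [ht, div_le_one (by positivity)]
    linarith
  have htn : n * (t * L) ≤ 1 := by
    rw [ht]
    have : n * (1 / (1 + n * L) * L) = n * L / (1 + n * L) := by ring
    rw [this, div_le_one (by positivity)]
    linarith
  set V := Finset.univ.filter (fun z => z ≠ x ∧ z ≠ y) with hV
  let f : Finset (Fin P) → Finset (Fin P) → ℝ := fun A B => hit A B
  let F : Fin r × Finset (Fin P) → Fin r × Finset (Fin P) → ℝ := fun u u' =>
    if u.1 = i ∧ u'.1 = i then f u.2 u'.2 else 0
  have hF0 : ∀ u u', 0 ≤ F u u' := fun u u' => by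
    dsimp only [F, f]
    split_ifs
    · exact hit_nonneg _ _
    · exact le_rfl
  have hprod : ∀ (ω : Cfg n r P) (w : Fin n), deg ω w = ℓ →
      t ^ ℓ ≤ ∏ z ∈ V, if adj ω w z then t else 1 := by
    intro ω w hw
    rw [Finset.prod_ite, Finset.prod_const, Finset.prod_const_one, mul_one]
    refine pow_le_pow_of_le_one ht0.le ht1 ?_
    rw [← hw, deg]
    exact Finset.card_le_card (Finset.filter_subset_filter _ (Finset.subset_univ _))
  have step1 : Pr μ K α (fun ω : Cfg n r P => ω.1 x = i ∧ deg ω x = ℓ ∧ ω.1 y = i ∧ deg ω y = ℓ ∧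
      adj ω x y) ≤ (1 + n * L) ^ (2 * ℓ) * ∑ ω : Cfg n r P, wt μ K α ω *
      (F (ω.1 x, ω.2.1 x) (ω.1 y, ω.2.1 y) *
        ∏ z ∈ V, ((if adj ω x z then t else 1) * (if adj ω y z then t else 1))) := by
    rw [Pr, Finset.mul_sum]
    refine Finset.sum_le_sum fun ω _ => ?_
    have hw := wt_nonneg hμ K hα0 hα1 ω
    have hprod0 : 0 ≤ ∏ z ∈ V, ((if adj ω x z then t else 1) * (if adj ω y z then t else 1)) :=
      Finset.prod_nonneg fun z _ => by split_ifs <;> positivity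
    split_ifs with hE
    · obtain ⟨h1, h2, h3, h4, h5⟩ := hE
      have hF : F (ω.1 x, ω.2.1 x) (ω.1 y, ω.2.1 y) = 1 := by
        simp [F, f, h1, h3, hit, h5.2.1]
      rw [hF, one_mul, Finset.prod_mul_distrib]
      have hmul := mul_le_mul (hprod ω x h2) (hprod ω y h4) (by positivity)
        ((pow_nonneg ht0.le ℓ).trans (hprod ω x h2))
      have hone : (1 + n * L) ^ (2 * ℓ) * (t ^ ℓ * t ^ ℓ) = 1 := by
        rw [← pow_add, ← two_mul, ← mul_pow, ht, mul_one_div_cancel (by positivity), one_pow]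
      calc wt μ K α ω = wt μ K α ω * ((1 + n * L) ^ (2 * ℓ) * (t ^ ℓ * t ^ ℓ)) := by
            rw [hone, mul_one]
        _ ≤ wt μ K α ω * ((1 + n * L) ^ (2 * ℓ) * ((∏ z ∈ V, if adj ω x z then t else 1) *
            ∏ z ∈ V, if adj ω y z then t else 1)) := by gcongr
        _ = _ := by ring
    · exact mul_nonneg (by positivity) (mul_nonneg hw (mul_nonneg (hF0 _ _) hprod0))
  have step2 : ∀ A B : Finset (Fin P), A.card = K i → B.card = K i →
      ∏ z ∈ V, ∑ v : Fin r × Finset (Fin P), vtxWt μ K v *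
        ((1 + α * hit A v.2 * (t - 1)) * (1 + α * hit B v.2 * (t - 1))) ≤
      Real.exp (-2 * (n * L) + 4 * L + 2 + 2 * (n * L ^ 2) / m) * (1 + d) ^ (A ∩ B).card := by
    intro A B hA hB
    have hnn : 0 ≤ ∑ v : Fin r × Finset (Fin P), vtxWt μ K v *
        ((1 + α * hit A v.2 * (t - 1)) * (1 + α * hit B v.2 * (t - 1))) := by
      have aux : ∀ C R : Finset (Fin P), 0 ≤ 1 + α * hit C R * (t - 1) := by
        intro C R
        have h1 : α * hit C R ≤ 1 := mul_le_one₀ hα1.le (hit_nonneg _ _) (hit_le_one _ _)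
        have h2 : 0 ≤ α * hit C R := mul_nonneg hα0.le (hit_nonneg _ _)
        nlinarith
      exact Finset.sum_nonneg fun v _ => mul_nonneg (vtxWt_nonneg hμ K v)
        (mul_nonneg (aux _ _) (aux _ _))
    have hq0 := bothHit_nonneg hμ K A B
    have hq := bothHit_le hμ hP hK i hKi hm hmμ hp5 hA hB
    set q := α ^ 2 * bothHit μ K A B with hqdef
    have hq0' : 0 ≤ q := by positivity
    have hle : ∑ v : Fin r × Finset (Fin P), vtxWt μ K v *
        ((1 + α * hit A v.2 * (t - 1)) * (1 + α * hit B v.2 * (t - 1))) ≤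
        Real.exp (-2 * L + 2 * (t * L) + q) := by
      rw [sum_vtxWt_two_edges hμsum hK i hA hB, ← hL, ← hqdef]
      have h1 : (t - 1) * (t - 1) * q ≤ q := by
        have : (t - 1) * (t - 1) ≤ 1 := by nlinarith
        nlinarith
      have h2 := Real.add_one_le_exp (-2 * L + 2 * (t * L) + q)
      nlinarith
    rw [Finset.prod_const, hV, card_filter_ne_ne hxy]
    refine (pow_le_pow_left₀ hnn hle _).trans ?_
    have hpow : Real.exp (n * α * L * (5 / 4) / K i) ^ (A ∩ B).card ≤ (1 + d) ^ (A ∩ B).card := by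
      gcongr
    refine le_trans ?_ (mul_le_mul_of_nonneg_left hpow (Real.exp_pos _).le)
    rw [← Real.exp_nat_mul, ← Real.exp_nat_mul, ← Real.exp_add]
    apply Real.exp_le_exp.2
    have hcast : ((n - 2 : ℕ) : ℝ) = n - 2 := by push_cast [Nat.cast_sub hn2]; ring
    rw [hcast]
    have hqn : n * q ≤ (A ∩ B).card * (n * α * L * (5 / 4) / K i) + 2 * (n * L ^ 2) / m := by
      calc n * q ≤ n * (α ^ 2 * (5 / 4 * ((A ∩ B).card / K i) * lam μ P K i +
            2 * lam μ P K i ^ 2 / m)) := by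
            rw [hqdef]
            gcongr
        _ = _ := by
            rw [hL]
            ring
    have htL : 0 ≤ t * L := by positivity
    nlinarith
  refine step1.trans ?_
  rw [hV, sum_wt_mul μ K α x y hxy F (fun _ => t) (fun _ => 1) (fun _ => t) (fun _ => 1), ← hV]
  have step3 : ∑ u : Fin r × Finset (Fin P), ∑ u' : Fin r × Finset (Fin P),
      vtxWt μ K u * vtxWt μ K u' * F u u' *
      ∏ z ∈ V, ∑ v : Fin r × Finset (Fin P), vtxWt μ K v *
        ((1 + α * hit u.2 v.2 * (t - 1)) * (1 + α * hit u'.2 v.2 * (t - 1))) ≤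
      Real.exp (-2 * (n * L) + 4 * L + 2 + 2 * (n * L ^ 2) / m) *
       (μ i ^ 2 * (Real.exp (d * (5 / 4 * pEdge P K i i)) - (1 - pEdge P K i i))) := by
    have h1 := sum_sum_vtxWt_class μ K i (fun A B : Finset (Fin P) => hit A B *
      ∏ z ∈ V, ∑ v : Fin r × Finset (Fin P), vtxWt μ K v *
        ((1 + α * hit A v.2 * (t - 1)) * (1 + α * hit B v.2 * (t - 1))))
    have h2 : ∀ u u' : Fin r × Finset (Fin P), vtxWt μ K u * vtxWt μ K u' * F u u' *
      ∏ z ∈ V, ∑ v : Fin r × Finset (Fin P), vtxWt μ K v *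
        ((1 + α * hit u.2 v.2 * (t - 1)) * (1 + α * hit u'.2 v.2 * (t - 1))) =
      vtxWt μ K u * vtxWt μ K u' * (if u.1 = i ∧ u'.1 = i then hit u.2 u'.2 *
      ∏ z ∈ V, ∑ v : Fin r × Finset (Fin P), vtxWt μ K v *
        ((1 + α * hit u.2 v.2 * (t - 1)) * (1 + α * hit u'.2 v.2 * (t - 1))) else 0) := by
      intro u u'
      simp only [F, f]
      split_ifs <;> ring
    simp_rw [h2]
    rw [h1, mul_left_comm]
    refine mul_le_mul_of_nonneg_left ?_ (by positivity)
    set E := Real.exp (-2 * (n * L) + 4 * L + 2 + 2 * (n * L ^ 2) / m)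
    have hE : 0 < E := Real.exp_pos _
    have hbound : ∀ A : Finset (Fin P), A.card = K i → ∑ B, ringWt (K i) B * (hit A B *
      ∏ z ∈ V, ∑ v : Fin r × Finset (Fin P), vtxWt μ K v *
        ((1 + α * hit A v.2 * (t - 1)) * (1 + α * hit B v.2 * (t - 1)))) ≤
      E * (Real.exp (d * (5 / 4 * pEdge P K i i)) - (1 - pEdge P K i i)) := by
      intro A hA
      refine le_trans ?_ (mul_le_mul_of_nonneg_left
        (sum_ringWt_hit_mul_pow_le hP hK i (hp5 i) hd hA) hE.le)
      rw [Finset.mul_sum]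
      refine Finset.sum_le_sum fun B _ => ?_
      rw [mul_left_comm E]
      refine ringWt_mul_congr fun hB => ?_
      rw [mul_left_comm E]
      exact mul_le_mul_of_nonneg_left (step2 A B hA hB) (hit_nonneg _ _)
    calc _ ≤ ∑ A, ringWt (K i) A *
          (E * (Real.exp (d * (5 / 4 * pEdge P K i i)) - (1 - pEdge P K i i))) :=
          Finset.sum_le_sum fun A _ => ringWt_mul_congr fun hA => hbound A hA
      _ = _ := by rw [← Finset.sum_mul, sum_ringWt (hK i), one_mul]
  have hc := chanMass_pos n
  calc _ ≤ (1 + n * L) ^ (2 * ℓ) * (chanMass n *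
      (Real.exp (-2 * (n * L) + 4 * L + 2 + 2 * (n * L ^ 2) / m) *
       (μ i ^ 2 * (Real.exp (d * (5 / 4 * pEdge P K i i)) - (1 - pEdge P K i i))))) := by
        gcongr
    _ = _ := by ring

/-- Indicator of membership in a finite set. -/
noncomputable def memInd {ι : Type*} (S : Finset ι) (z : ι) : ℝ :=
  if z ∈ S then 1 else 0

lemma prod_memInd_eq {ι : Type*} {V S : Finset ι} (hS : S ⊆ V) (p : ι → Prop) :
    ∏ z ∈ V, (if p z then memInd S z else 1 - memInd S z) = memInd {V.filter p} S := by
  simp only [memInd, Finset.mem_singleton]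
  split_ifs with h
  · refine Finset.prod_eq_one fun z hz => ?_
    by_cases hp : p z <;> simp [h, hp, hz]
  · by_contra hne
    apply h
    rw [← ne_eq, Finset.prod_ne_zero_iff] at hne
    ext z
    rw [Finset.mem_filter]
    constructor
    · intro hz
      refine ⟨hS hz, ?_⟩
      by_contra ha
      exact hne z (hS hz) (by simp [ha, hz])
    · rintro ⟨hz, ha⟩
      by_contra hzS
      exact hne z hz (by simp [ha, hzS])

/-- Ordered pairs of disjoint `ℓ`-element subsets of `V`. -/
noncomputable def disjointPairs {ι : Type*} (V : Finset ι) (ℓ : ℕ) :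
    Finset (Σ _ : Finset ι, Finset ι) :=
  (V.powersetCard ℓ).sigma fun S => (V \ S).powersetCard ℓ

lemma card_disjointPairs {ι : Type*} (V : Finset ι) (ℓ : ℕ) :
    (disjointPairs V ℓ).card = V.card.choose ℓ * (V.card - ℓ).choose ℓ := by
  rw [disjointPairs, Finset.card_sigma]
  have : ∀ S ∈ V.powersetCard ℓ, ((V \ S).powersetCard ℓ).card = (V.card - ℓ).choose ℓ := by
    intro S hS
    rw [Finset.mem_powersetCard] at hS
    rw [Finset.card_powersetCard, Finset.card_sdiff_of_subset hS.1, hS.2]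
  rw [Finset.sum_congr rfl this, Finset.sum_const, Finset.card_powersetCard, smul_eq_mul]

lemma mem_disjointPairs {ι : Type*} {V : Finset ι} {ℓ : ℕ} {J : Σ _ : Finset ι, Finset ι}
    (hJ : J ∈ disjointPairs V ℓ) :
    J.1 ⊆ V ∧ J.2 ⊆ V ∧ J.1.card = ℓ ∧ J.2.card = ℓ ∧ Disjoint J.1 J.2 := by
  simp only [disjointPairs, Finset.mem_sigma, Finset.mem_powersetCard] at hJ
  obtain ⟨⟨h1, h2⟩, h3, h4⟩ := hJ
  exact ⟨h1, h3.trans Finset.sdiff_subset, h2, h4,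
    (Finset.disjoint_of_subset_left h3 Finset.sdiff_disjoint).symm⟩

lemma sum_disjointPairs {ι : Type*} (V : Finset ι) (ℓ : ℕ) (p q : ι → Prop) :
    ∑ J ∈ disjointPairs V ℓ, ∏ z ∈ V, ((if p z then memInd J.1 z else 1 - memInd J.1 z) *
        (if q z then memInd J.2 z else 1 - memInd J.2 z)) =
      memInd (disjointPairs V ℓ) ⟨V.filter p, V.filter q⟩ := by
  have h : ∀ J ∈ disjointPairs V ℓ,
      ∏ z ∈ V, ((if p z then memInd J.1 z else 1 - memInd J.1 z) *
        (if q z then memInd J.2 z else 1 - memInd J.2 z)) =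
      if (⟨V.filter p, V.filter q⟩ : Σ _ : Finset ι, Finset ι) = J then 1 else 0 := by
    rintro ⟨S, T⟩ hJ
    obtain ⟨h1, h2, -⟩ := mem_disjointPairs hJ
    rw [Finset.prod_mul_distrib, prod_memInd_eq h1, prod_memInd_eq h2]
    simp only [memInd, Finset.mem_singleton, Sigma.mk.injEq, heq_eq_eq, eq_comm (b := S),
      eq_comm (b := T), ite_and]
    by_cases hS : S = V.filter p <;> by_cases hT : T = V.filter q <;> simp [hS, hT]
  rw [Finset.sum_congr rfl h, Finset.sum_ite_eq, memInd]
  congr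

/-- The disjoint-ring, prescribed-neighbourhood events are disjoint subevents of the joint event
without adjacency. -/
lemma sum_disjointPairs_le_Pr {n r P : ℕ} {μ : Fin r → ℝ} (hμ : ∀ i, 0 < μ i)
    (K : Fin r → ℕ) {α : ℝ} (hα0 : 0 < α) (hα1 : α < 1) (x y : Fin n) (i : Fin r) (ℓ : ℕ) :
    ∑ J ∈ disjointPairs (Finset.univ.filter fun z => z ≠ x ∧ z ≠ y) ℓ,
      ∑ ω : Cfg n r P, wt μ K α ω *
      ((if ω.1 x = i ∧ ω.1 y = i then 1 - hit (ω.2.1 x) (ω.2.1 y) else 0) *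
        ∏ z ∈ Finset.univ.filter (fun z => z ≠ x ∧ z ≠ y),
        ((if adj ω x z then memInd J.1 z else 1 - memInd J.1 z) *
          (if adj ω y z then memInd J.2 z else 1 - memInd J.2 z))) ≤
      Pr μ K α (fun ω : Cfg n r P => ω.1 x = i ∧ deg ω x = ℓ ∧ ω.1 y = i ∧ deg ω y = ℓ ∧
      ¬ adj ω x y) := by
  rw [Finset.sum_comm, Pr]
  refine Finset.sum_le_sum fun ω _ => ?_
  rw [← Finset.mul_sum, ← Finset.mul_sum, sum_disjointPairs]
  have hw := wt_nonneg hμ K hα0 hα1 ω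
  have hnn : ∀ (p : Prop) (_ : Decidable p), 0 ≤ if p then wt μ K α ω else 0 := by
    intro p _
    split_ifs
    · exact hw
    · exact le_rfl
  by_cases hcls : ω.1 x = i ∧ ω.1 y = i
  swap
  · rw [if_neg hcls, zero_mul, mul_zero]
    exact hnn _ _
  rw [if_pos hcls]
  by_cases hdis : (ω.2.1 x ∩ ω.2.1 y).Nonempty
  · rw [hit, if_pos hdis, sub_self, zero_mul, mul_zero]
    exact hnn _ _
  by_cases hmem : (⟨(Finset.univ.filter fun z => z ≠ x ∧ z ≠ y).filter (adj ω x),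
      (Finset.univ.filter fun z => z ≠ x ∧ z ≠ y).filter (adj ω y)⟩ :
      Σ _ : Finset (Fin n), Finset (Fin n)) ∈
      disjointPairs (Finset.univ.filter fun z => z ≠ x ∧ z ≠ y) ℓ
  swap
  · rw [memInd, if_neg hmem, mul_zero, mul_zero]
    exact hnn _ _
  have hna : ¬ adj ω x y := fun h => hdis h.2.1
  have hna' : ¬ adj ω y x := fun h => hdis (by rw [Finset.inter_comm]; exact h.2.1)
  obtain ⟨-, -, h3, h4, -⟩ := mem_disjointPairs hmem
  have hdx : deg ω x = ℓ := by
    rw [← h3, deg]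
    congr 1
    ext z
    simp only [Finset.mem_filter, Finset.mem_univ, true_and]
    refine ⟨fun h => ⟨⟨h.1.symm, ?_⟩, h⟩, fun h => h.2⟩
    rintro rfl
    exact hna h
  have hdy : deg ω y = ℓ := by
    rw [← h4, deg]
    congr 1
    ext z
    simp only [Finset.mem_filter, Finset.mem_univ, true_and]
    refine ⟨fun h => ⟨⟨?_, h.1.symm⟩, h⟩, fun h => h.2⟩
    rintro rfl
    exact hna' h
  rw [if_pos ⟨hcls.1, hdx, hcls.2, hdy, hna⟩, hit, if_neg hdis, memInd, if_pos hmem, sub_zero,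
    mul_one, mul_one]

lemma le_prod_sum_vtxWt {n r P : ℕ} {μ : Fin r → ℝ} (hμ : ∀ i, 0 < μ i) (hμsum : ∑ i, μ i = 1)
    {K : Fin r → ℕ} (hP : 0 < P) (hK : ∀ i, K i ≤ P) {α : ℝ} (hα0 : 0 < α) (hα1 : α < 1)
    (i : Fin r) (hKi : 0 < K i) {m : ℝ} (hm : 0 < m)
    (hmμ : ∀ j, m ≤ μ j) (hp5 : ∀ j, pEdge P K i j ≤ 1 / 5) (hlam : 4 * lam μ P K i ≤ m) {L : ℝ}
    (hL : L = α * lam μ P K i) (hL2 : 2 * L ≤ 1) {ℓ : ℕ} {V : Finset (Fin n)}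
    {J : Σ _ : Finset (Fin n), Finset (Fin n)} (hJ : J ∈ disjointPairs V ℓ)
    {A B : Finset (Fin P)} (hA : A.card = K i) (hB : B.card = K i) (hAB : ¬ (A ∩ B).Nonempty) :
    (L / 2) ^ (2 * ℓ) * (1 - 2 * L) ^ n ≤
      ∏ z ∈ V, ∑ v : Fin r × Finset (Fin P), vtxWt μ K v *
        ((1 - memInd J.1 z + α * hit A v.2 * (memInd J.1 z - (1 - memInd J.1 z))) *
          (1 - memInd J.2 z + α * hit B v.2 * (memInd J.2 z - (1 - memInd J.2 z)))) := by
  have hlam0 : 0 ≤ lam μ P K i :=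
    Finset.sum_nonneg fun j _ => mul_nonneg (hμ j).le (pEdge_nonneg K i j)
  have hL0 : 0 ≤ L := hL ▸ mul_nonneg hα0.le hlam0
  obtain ⟨h1, h2, h3, h4, h5⟩ := mem_disjointPairs hJ
  have hq0 := bothHit_nonneg hμ K A B
  have hq := bothHit_le hμ hP hK i hKi hm hmμ hp5 hA hB
  rw [Finset.not_nonempty_iff_eq_empty] at hAB
  rw [hAB, Finset.card_empty, Nat.cast_zero, zero_div, mul_zero, zero_mul, zero_add] at hq
  set q := α ^ 2 * bothHit μ K A B with hqdef
  have hq0' : 0 ≤ q := by positivity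
  have hqL : q ≤ L / 2 := by
    have e1 : 2 * lam μ P K i ^ 2 / m ≤ lam μ P K i / 2 := by
      rw [div_le_iff₀ hm]
      nlinarith
    have e2 : α ^ 2 ≤ α := by nlinarith
    calc q ≤ α * (lam μ P K i / 2) := by
          rw [hqdef]
          exact mul_le_mul e2 (hq.trans e1) hq0 hα0.le
      _ = L / 2 := by rw [hL]; ring
  have hfac : ∀ z ∈ V, (if z ∈ J.1 ∪ J.2 then L / 2 else 1 - 2 * L) ≤
      ∑ v : Fin r × Finset (Fin P), vtxWt μ K v *
      ((1 - memInd J.1 z + α * hit A v.2 * (memInd J.1 z - (1 - memInd J.1 z))) *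
        (1 - memInd J.2 z + α * hit B v.2 * (memInd J.2 z - (1 - memInd J.2 z)))) := by
    intro z _
    rw [sum_vtxWt_two_edges hμsum hK i hA hB, ← hL, ← hqdef]
    by_cases hz1 : z ∈ J.1
    · have hz2 : z ∉ J.2 := Finset.disjoint_left.1 h5 hz1
      simp only [memInd, hz1, hz2, Finset.mem_union, true_or, if_true, if_false]
      linarith
    · by_cases hz2 : z ∈ J.2
      · simp only [memInd, hz1, hz2, Finset.mem_union, or_true, if_true, if_false]
        linarith
      · simp only [memInd, hz1, hz2, Finset.mem_union, or_false, if_false]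
        linarith
  refine le_trans ?_ (Finset.prod_le_prod (fun z _ => by split_ifs <;> linarith) hfac)
  rw [Finset.prod_ite, Finset.prod_const, Finset.prod_const]
  have hc1 : (V.filter (fun z => z ∈ J.1 ∪ J.2)).card = 2 * ℓ := by
    have : V.filter (fun z => z ∈ J.1 ∪ J.2) = J.1 ∪ J.2 := by
      ext z
      simp only [Finset.mem_filter, and_iff_right_iff_imp]
      exact fun hz => Finset.union_subset h1 h2 hz
    rw [this, Finset.card_union_of_disjoint h5, h3, h4, two_mul]
  rw [hc1]
  refine mul_le_mul_of_nonneg_left ?_ (by positivity)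
  refine pow_le_pow_of_le_one (by linarith) (by linarith) ?_
  exact (Finset.card_le_univ _).trans (by simp)

/-- Lower bound for the joint event without adjacency. -/
lemma le_Pr_not_adjacent {n r P : ℕ} {μ : Fin r → ℝ} (hμ : ∀ i, 0 < μ i) (hμsum : ∑ i, μ i = 1)
    {K : Fin r → ℕ} (hP : 0 < P) (hK : ∀ i, K i ≤ P) {α : ℝ} (hα0 : 0 < α) (hα1 : α < 1)
    {x y : Fin n} (hxy : x ≠ y) (i : Fin r) (hKi : 0 < K i) {m : ℝ} (hm : 0 < m)
    (hmμ : ∀ j, m ≤ μ j) (hp5 : ∀ j, pEdge P K i j ≤ 1 / 5) (hlam : 4 * lam μ P K i ≤ m) {L : ℝ}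
    (hL : L = α * lam μ P K i) (hL2 : 2 * L ≤ 1) (ℓ : ℕ) :
    chanMass n * (((n - 2).choose ℓ * (n - 2 - ℓ).choose ℓ : ℝ) *
      ((L / 2) ^ (2 * ℓ) * (1 - 2 * L) ^ n) * (μ i ^ 2 * (1 - pEdge P K i i))) ≤
    Pr μ K α (fun ω : Cfg n r P => ω.1 x = i ∧ deg ω x = ℓ ∧ ω.1 y = i ∧ deg ω y = ℓ ∧
      ¬ adj ω x y) := by
  refine le_trans ?_ (sum_disjointPairs_le_Pr hμ K hα0 hα1 x y i ℓ)
  have hI := card_disjointPairs (Finset.univ.filter fun z => z ≠ x ∧ z ≠ y) ℓ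
  rw [card_filter_ne_ne hxy] at hI
  set lo := (L / 2) ^ (2 * ℓ) * (1 - 2 * L) ^ n with hlo
  have hJle : ∀ J ∈ disjointPairs (Finset.univ.filter fun z => z ≠ x ∧ z ≠ y) ℓ,
      chanMass n * (lo * (μ i ^ 2 * (1 - pEdge P K i i))) ≤ ∑ ω : Cfg n r P, wt μ K α ω *
      ((if ω.1 x = i ∧ ω.1 y = i then 1 - hit (ω.2.1 x) (ω.2.1 y) else 0) *
        ∏ z ∈ Finset.univ.filter (fun z => z ≠ x ∧ z ≠ y),
        ((if adj ω x z then memInd J.1 z else 1 - memInd J.1 z) *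
          (if adj ω y z then memInd J.2 z else 1 - memInd J.2 z))) := by
    intro J hJ
    rw [sum_wt_mul μ K α x y hxy (fun u u' => if u.1 = i ∧ u'.1 = i then 1 - hit u.2 u'.2 else 0)]
    refine mul_le_mul_of_nonneg_left ?_ (chanMass_pos n).le
    set V := Finset.univ.filter (fun z => z ≠ x ∧ z ≠ y)
    let Q : Finset (Fin P) → Finset (Fin P) → ℝ := fun A B =>
      ∏ z ∈ V, ∑ v : Fin r × Finset (Fin P), vtxWt μ K v *
        ((1 - memInd J.1 z + α * hit A v.2 * (memInd J.1 z - (1 - memInd J.1 z))) *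
          (1 - memInd J.2 z + α * hit B v.2 * (memInd J.2 z - (1 - memInd J.2 z))))
    have hQ : ∀ A B : Finset (Fin P), A.card = K i → B.card = K i → ¬ (A ∩ B).Nonempty →
        lo ≤ Q A B := fun A B hA hB hAB =>
      le_prod_sum_vtxWt hμ hμsum hP hK hα0 hα1 i hKi hm hmμ hp5 hlam hL hL2 hJ hA hB hAB
    change _ ≤ ∑ u : Fin r × Finset (Fin P), ∑ u' : Fin r × Finset (Fin P),
        vtxWt μ K u * vtxWt μ K u' * (if u.1 = i ∧ u'.1 = i then 1 - hit u.2 u'.2 else 0) *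
          Q u.2 u'.2
    clear_value Q
    have h1 := sum_sum_vtxWt_class μ K i (fun A B : Finset (Fin P) => (1 - hit A B) * Q A B)
    have h2 : ∀ u u' : Fin r × Finset (Fin P), vtxWt μ K u * vtxWt μ K u' *
        (if u.1 = i ∧ u'.1 = i then 1 - hit u.2 u'.2 else 0) * Q u.2 u'.2 =
      vtxWt μ K u * vtxWt μ K u' * (if u.1 = i ∧ u'.1 = i then (1 - hit u.2 u'.2) * Q u.2 u'.2
        else 0) := by
      intro u u'
      split_ifs <;> ring
    simp_rw [h2]
    rw [h1, mul_left_comm]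
    refine mul_le_mul_of_nonneg_left ?_ (by positivity)
    have hA : ∀ A : Finset (Fin P), A.card = K i → lo * (1 - pEdge P K i i) ≤
        ∑ B, ringWt (K i) B * ((1 - hit A B) * Q A B) := by
      intro A hA
      rw [← sum_ringWt_hit hK i i hA]
      calc lo * (1 - ∑ B, ringWt (K i) B * hit A B)
          = lo * (∑ B : Finset (Fin P), ringWt (K i) B - ∑ B, ringWt (K i) B * hit A B) := by
            rw [sum_ringWt (hK i)]
        _ = ∑ B, ringWt (K i) B * ((1 - hit A B) * lo) := by
            rw [← Finset.sum_sub_distrib, Finset.mul_sum]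
            exact Finset.sum_congr rfl fun B _ => by ring
        _ ≤ _ := by
            refine Finset.sum_le_sum fun B _ => ringWt_mul_congr fun hB => ?_
            by_cases hAB : (A ∩ B).Nonempty
            · simp [hit, hAB]
            · exact mul_le_mul_of_nonneg_left (hQ A B hA hB hAB)
                (sub_nonneg.2 (hit_le_one _ _))
    calc lo * (1 - pEdge P K i i)
        = ∑ A : Finset (Fin P), ringWt (K i) A * (lo * (1 - pEdge P K i i)) := by
          rw [← Finset.sum_mul, sum_ringWt (hK i), one_mul]
      _ ≤ _ := Finset.sum_le_sum fun A _ => ringWt_mul_congr (hA A)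
  refine le_trans (le_of_eq ?_) (Finset.sum_le_sum hJle)
  rw [Finset.sum_const, nsmul_eq_mul, hI]
  push_cast
  ring

lemma exp_le_one_sub {x : ℝ} (hx : x ≤ 1 / 2) :
    Real.exp (-(x + 2 * x ^ 2)) ≤ 1 - x := by
  rw [Real.exp_neg, inv_le_comm₀ (Real.exp_pos _) (by linarith)]
  have h := Real.add_one_le_exp (x + 2 * x ^ 2)
  refine le_trans ?_ h
  rw [inv_eq_one_div, div_le_iff₀ (by linarith)]
  nlinarith [mul_nonneg (sq_nonneg x) (by linarith : (0 : ℝ) ≤ 1 - 2 * x)]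

lemma pow_half_le_choose_mul {n a ℓ : ℕ} (h : n + 2 * ℓ ≤ 2 * a + 2) :
    ((n : ℝ) / 2) ^ ℓ ≤ ℓ.factorial * a.choose ℓ := by
  have h1 : ((a + 1 - ℓ : ℕ) ^ ℓ : ℝ) ≤ ℓ.factorial * a.choose ℓ := by
    exact_mod_cast Nat.pow_sub_le_descFactorial a ℓ |>.trans
      (Nat.descFactorial_eq_factorial_mul_choose a ℓ).le
  refine le_trans (pow_le_pow_left₀ (by positivity) ?_ ℓ) h1
  have : (n : ℝ) ≤ 2 * (a + 1 - ℓ : ℕ) := by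
    exact_mod_cast (by omega : n ≤ 2 * (a + 1 - ℓ))
  linarith

lemma upper_le_const_mul_lower {n ℓ : ℕ} {c m L : ℝ} (hc : 0 < c) (hL0 : 0 ≤ L)
    (hcL : c ≤ n * L) (hL : 2 * L ≤ 1 / 2) (hLm : 4 * L + 2 * (n * L ^ 2) / m ≤ 1 / 2)
    (hL8 : 8 * (n * L ^ 2) ≤ 1 / 2) (hn : 4 * ℓ + 2 ≤ n) :
    (1 + n * L) ^ (2 * ℓ) * Real.exp (-2 * (n * L) + 4 * L + 2 + 2 * (n * L ^ 2) / m) ≤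
      ((4 * (1 / c + 1)) ^ (2 * ℓ) * (ℓ.factorial : ℝ) ^ 2 * Real.exp 3) *
        (((n - 2).choose ℓ * (n - 2 - ℓ).choose ℓ : ℝ) *
          ((L / 2) ^ (2 * ℓ) * (1 - 2 * L) ^ n)) := by
  have h1 : Real.exp (-2 * (n * L) + 4 * L + 2 + 2 * (n * L ^ 2) / m) ≤
      Real.exp 3 * (1 - 2 * L) ^ n := by
    have := pow_le_pow_left₀ (Real.exp_pos _).le
      (exp_le_one_sub (x := 2 * L) hL) n
    rw [← Real.exp_nat_mul] at this
    refine le_trans ?_ (mul_le_mul_of_nonneg_left this (Real.exp_pos 3).le)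
    rw [← Real.exp_add]
    refine Real.exp_le_exp.2 ?_
    have : (n : ℝ) * -(2 * L + 2 * (2 * L) ^ 2) = -2 * (n * L) - 8 * (n * L ^ 2) := by ring
    rw [this]
    linarith
  have h2 : (1 + n * L) ≤ (4 * (1 / c + 1)) * ((n : ℝ) / 2 * (L / 2)) := by
    have : 1 ≤ 1 / c * (n * L) := by
      rw [one_div, inv_mul_eq_div, le_div_iff₀ hc]
      linarith
    nlinarith
  have h3 : (n / 2 : ℝ) ^ (2 * ℓ) ≤
      (ℓ.factorial : ℝ) ^ 2 * ((n - 2).choose ℓ * (n - 2 - ℓ).choose ℓ) := by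
    have e1 := pow_half_le_choose_mul (n := n) (a := n - 2) (ℓ := ℓ) (by omega)
    have e2 := pow_half_le_choose_mul (n := n) (a := n - 2 - ℓ) (ℓ := ℓ) (by omega)
    calc (n / 2 : ℝ) ^ (2 * ℓ) = (n / 2 : ℝ) ^ ℓ * (n / 2 : ℝ) ^ ℓ := by rw [two_mul, pow_add]
      _ ≤ _ := mul_le_mul e1 e2 (by positivity) (by positivity)
      _ = _ := by ring
  have h4 : (1 + n * L) ^ (2 * ℓ) ≤ (4 * (1 / c + 1)) ^ (2 * ℓ) *
      ((ℓ.factorial : ℝ) ^ 2 * ((n - 2).choose ℓ * (n - 2 - ℓ).choose ℓ) *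
        (L / 2) ^ (2 * ℓ)) := by
    refine (pow_le_pow_left₀ (by positivity) h2 _).trans ?_
    rw [mul_pow (4 * (1 / c + 1)), mul_pow (n / 2 : ℝ)]
    exact mul_le_mul_of_nonneg_left (mul_le_mul_of_nonneg_right h3 (by positivity))
      (by positivity)
  refine (mul_le_mul h4 h1 (Real.exp_pos _).le (by positivity)).trans (le_of_eq ?_)
  ring

lemma exp_mul_le_one_add {α s : ℝ} (hα0 : 0 ≤ α) (hα1 : α ≤ 1) :
    Real.exp (α * s) ≤ 1 + α * Real.exp s := by
  have h := convexOn_exp.2 (Set.mem_univ (0 : ℝ)) (Set.mem_univ s)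
    (by linarith : 0 ≤ 1 - α) hα0 (by ring)
  simp only [smul_eq_mul, mul_zero, zero_add, Real.exp_zero] at h
  linarith

/-- Nonasymptotic comparison of the joint events with and without adjacency. -/
lemma Pr_adjacent_le_mul {n r P : ℕ} {μ : Fin r → ℝ} (hμ : ∀ i, 0 < μ i) (hμsum : ∑ i, μ i = 1)
    {K : Fin r → ℕ} (hP : 0 < P) (hK : ∀ i, K i ≤ P) {α : ℝ} (hα0 : 0 < α) (hα1 : α < 1)
    {x y : Fin n} (hxy : x ≠ y) (i : Fin r) (hKi : 2 ≤ K i) {m c : ℝ} (hm : 0 < m) (hc : 0 < c)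
    (hmμ : ∀ j, m ≤ μ j) (hlam : 5 * lam μ P K i ≤ m) {L : ℝ}
    (hL : L = α * lam μ P K i) (hcL : c ≤ n * L) (hLlog : n * L ≤ 6 / 5 * Real.log n)
    (hL2 : 2 * L ≤ 1 / 2) (hLm : 4 * L + 2 * (n * L ^ 2) / m ≤ 1 / 2)
    (hL8 : 8 * (n * L ^ 2) ≤ 1 / 2) {ℓ : ℕ} (hn : 4 * ℓ + 2 ≤ n) :
    Pr μ K α (fun ω : Cfg n r P => ω.1 x = i ∧ deg ω x = ℓ ∧ ω.1 y = i ∧ deg ω y = ℓ ∧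
      adj ω x y) ≤
    (((4 * (1 / c + 1)) ^ (2 * ℓ) * (ℓ.factorial : ℝ) ^ 2 * Real.exp 3) * (5 / 4) *
      (Real.exp (5 / 4 * (L * Real.exp (3 / 4 * Real.log n)) / m) - 1 + lam μ P K i / m)) *
    Pr μ K α (fun ω : Cfg n r P => ω.1 x = i ∧ deg ω x = ℓ ∧ ω.1 y = i ∧ deg ω y = ℓ ∧
      ¬ adj ω x y) := by
  have hlam0 : 0 ≤ lam μ P K i :=
    Finset.sum_nonneg fun j _ => mul_nonneg (hμ j).le (pEdge_nonneg K i j)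
  have hL0 : 0 ≤ L := hL ▸ mul_nonneg hα0.le hlam0
  have hp : ∀ j, pEdge P K i j ≤ lam μ P K i / m := by
    intro j
    rw [le_div_iff₀ hm]
    nlinarith [mul_pEdge_le_lam hμ (P := P) K i j, hmμ j, pEdge_nonneg (P := P) K i j]
  have hp5 : ∀ j, pEdge P K i j ≤ 1 / 5 := by
    intro j
    refine (hp j).trans ?_
    rw [div_le_iff₀ hm]
    linarith
  set p := pEdge P K i i
  have hp0 : 0 ≤ p := pEdge_nonneg K i i
  set E := Real.exp (3 / 4 * Real.log n) with hE
  have hE0 : 0 < E := Real.exp_pos _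
  have hexp : Real.exp (n * α * L * (5 / 4) / K i) ≤ 1 + α * E := by
    refine le_trans (Real.exp_le_exp.2 ?_) (exp_mul_le_one_add hα0.le hα1.le)
    have hK2 : (2 : ℝ) ≤ K i := by exact_mod_cast hKi
    rw [div_le_iff₀ (by linarith)]
    have h1 : n * L * (5 / 4) ≤ 3 / 4 * Real.log n * 2 := by linarith
    have h2 : 3 / 4 * Real.log n * 2 ≤ 3 / 4 * Real.log n * K i :=
      mul_le_mul_of_nonneg_left hK2 (by linarith)
    calc n * α * L * (5 / 4) = α * (n * L * (5 / 4)) := by ring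
      _ ≤ α * (3 / 4 * Real.log n * K i) := mul_le_mul_of_nonneg_left (h1.trans h2) hα0.le
      _ = _ := by ring
  have hup := Pr_adjacent_le hμ hμsum hP hK hα0 hα1 hxy i (by omega) hm hmμ hp5 hL
    (by positivity : 0 ≤ α * E) hexp ℓ
  have hlo := le_Pr_not_adjacent hμ hμsum hP hK hα0 hα1 hxy i (by omega) hm hmμ hp5
    (by linarith) hL (by linarith) ℓ
  have hXY := upper_le_const_mul_lower (ℓ := ℓ) hc hL0 hcL hL2 hLm hL8 hn
  set C := (4 * (1 / c + 1)) ^ (2 * ℓ) * (ℓ.factorial : ℝ) ^ 2 * Real.exp 3 with hC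
  have hC0 : 0 ≤ C := by positivity
  set X := (((n - 2).choose ℓ * (n - 2 - ℓ).choose ℓ : ℝ) * ((L / 2) ^ (2 * ℓ) * (1 - 2 * L) ^ n))
  have hX0 : 0 ≤ X := by
    have : 0 ≤ 1 - 2 * L := by linarith
    positivity
  have hδ : Real.exp (α * E * (5 / 4 * p)) - (1 - p) ≤
      Real.exp (5 / 4 * (L * E) / m) - 1 + lam μ P K i / m := by
    have h1 : α * E * (5 / 4 * p) ≤ 5 / 4 * (L * E) / m := by
      calc α * E * (5 / 4 * p) ≤ α * E * (5 / 4 * (lam μ P K i / m)) :=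
            mul_le_mul_of_nonneg_left (by linarith [hp i]) (by positivity)
        _ = 5 / 4 * (L * E) / m := by rw [hL]; ring
    have := Real.exp_le_exp.2 h1
    linarith [hp i]
  set δ := Real.exp (5 / 4 * (L * E) / m) - 1 + lam μ P K i / m
  have hδ0 : 0 ≤ Real.exp (α * E * (5 / 4 * p)) - (1 - p) := by
    have := Real.one_le_exp (by positivity : 0 ≤ α * E * (5 / 4 * p))
    linarith
  have hcm := (chanMass_pos n).le
  have hp45 : (4 / 5 : ℝ) ≤ 1 - p := by linarith [hp5 i]
  refine hup.trans ?_
  calc _ ≤ chanMass n * (C * X * (μ i ^ 2 * δ)) := by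
        refine mul_le_mul_of_nonneg_left ?_ hcm
        exact mul_le_mul hXY (mul_le_mul_of_nonneg_left hδ (by positivity)) (by positivity)
          (by positivity)
    _ = C * (5 / 4) * δ * (chanMass n * (X * (μ i ^ 2 * (4 / 5)))) := by ring
    _ ≤ C * (5 / 4) * δ * (chanMass n * (X * (μ i ^ 2 * (1 - p)))) := by
        have : 0 ≤ δ := hδ0.trans hδ
        gcongr
    _ ≤ _ := mul_le_mul_of_nonneg_left hlo (by
        have : 0 ≤ δ := hδ0.trans hδ
        positivity)

lemma tendsto_mul_exp_log {L : ℕ → ℝ} (hL0 : ∀ᶠ n in atTop, 0 ≤ L n)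
    (hLlog : ∀ᶠ n : ℕ in atTop, n * L n ≤ 6 / 5 * Real.log n) :
    Tendsto (fun n : ℕ => L n * Real.exp (3 / 4 * Real.log n)) atTop (nhds 0) := by
  have hlog : Tendsto (fun n : ℕ => Real.log n / 4) atTop atTop :=
    (Real.tendsto_log_atTop.comp tendsto_natCast_atTop_atTop).atTop_div_const (by norm_num)
  have h := ((Real.tendsto_pow_mul_exp_neg_atTop_nhds_zero 1).comp hlog).const_mul (24 / 5)
  rw [mul_zero] at h
  refine squeeze_zero' ?_ ?_ h
  · filter_upwards [hL0] with n hn using by positivity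
  · filter_upwards [hLlog, eventually_ge_atTop 1] with n hn hn1
    have hn0 : (0 : ℝ) < n := by exact_mod_cast hn1
    have he : Real.exp (3 / 4 * Real.log n) = n * Real.exp (-(Real.log n / 4)) := by
      rw [← Real.exp_log hn0, Real.log_exp, ← Real.exp_add]
      congr 1
      ring
    simp only [Function.comp_apply, pow_one]
    rw [he]
    nlinarith [mul_le_mul_of_nonneg_right hn (Real.exp_pos (-(Real.log n / 4))).le]

lemma eventually_le_log {k : ℝ} {γ : ℕ → ℝ} (hγ : Tendsto γ atTop atBot) :
    ∀ᶠ n : ℕ in atTop,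
      Real.log n + k * Real.log (Real.log n) + γ n ≤ 6 / 5 * Real.log n := by
  have hlog : Tendsto (fun n : ℕ => Real.log n) atTop atTop :=
    Real.tendsto_log_atTop.comp tendsto_natCast_atTop_atTop
  have h := ((Real.isLittleO_log_id_atTop.const_mul_left k).comp_tendsto hlog).def
    (by norm_num : (0 : ℝ) < 1 / 5)
  filter_upwards [h, hγ.eventually_le_atBot 0, hlog.eventually_ge_atTop 0] with n h1 h2 h3
  simp only [Function.comp_apply, id, Real.norm_eq_abs, abs_of_nonneg h3] at h1
  linarith [le_abs_self (k * Real.log (Real.log n))]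

lemma Pr_nonneg {n r P : ℕ} {μ : Fin r → ℝ} (hμ : ∀ i, 0 < μ i) (K : Fin r → ℕ) {α : ℝ}
    (hα0 : 0 < α) (hα1 : α < 1) (E : Cfg n r P → Prop) : 0 ≤ Pr μ K α E :=
  Finset.sum_nonneg fun ω _ => by
    split_ifs
    · exact wt_nonneg hμ K hα0 hα1 ω
    · exact le_rfl

/-- Proposition C.2: the adjacent contribution is negligible compared to the
non-adjacent one. -/
theorem joint_prob_adjacent_negligible
    (r : ℕ) (hr : 0 < r) (μ : Fin r → ℝ)
    (hμpos : ∀ i, 0 < μ i) (hμsum : ∑ i, μ i = 1)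
    (Kf : ℕ → Fin r → ℕ) (Pf : ℕ → ℕ) (αf : ℕ → ℝ)
    (hKmono : ∀ n, 2 ≤ n → ∀ i j : Fin r, i ≤ j → Kf n i ≤ Kf n j)
    (hK2 : ∀ n, 2 ≤ n → 2 ≤ Kf n ⟨0, hr⟩)
    (hKP : ∀ n, 2 ≤ n → 2 * Kf n ⟨r - 1, Nat.sub_lt hr Nat.one_pos⟩ ≤ Pf n)
    (hα : ∀ n, 2 ≤ n → 0 < αf n ∧ αf n < 1)
    (k : ℕ) (hk : 1 ≤ k) (γ : ℕ → ℝ)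
    (hγdef : ∀ n, 2 ≤ n → αf n * lam μ (Pf n) (Kf n) (⟨0, hr⟩ : Fin r) =
      (Real.log n + ((k : ℝ) - 1) * Real.log (Real.log n) + γ n) / n)
    (hlam : Tendsto (fun n : ℕ => lam μ (Pf n) (Kf n) (⟨0, hr⟩ : Fin r)) atTop (nhds 0))
    (hγ : Tendsto γ atTop atBot)
    (hΩ : ∃ c : ℝ, 0 < c ∧ ∀ᶠ n : ℕ in atTop, c ≤ ((n : ℝ) * (αf n * lam μ (Pf n) (Kf n) (⟨0, hr⟩ : Fin r))))
    (vx vy : ℕ → ℕ) (hv : ∀ n, 2 ≤ n → vx n < n ∧ vy n < n ∧ vx n ≠ vy n) :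
    ∀ ℓ : ℕ, Tendsto (fun n : ℕ =>
      Pr (n := n) (P := Pf n) μ (Kf n) (αf n)
        (fun ω => (∃ (hx : vx n < n) (hy : vy n < n), ω.1 ⟨vx n, hx⟩ = (⟨0, hr⟩ : Fin r) ∧ deg ω ⟨vx n, hx⟩ = ℓ ∧ ω.1 ⟨vy n, hy⟩ = (⟨0, hr⟩ : Fin r) ∧ deg ω ⟨vy n, hy⟩ = ℓ ∧ adj ω ⟨vx n, hx⟩ ⟨vy n, hy⟩)) /
      Pr (n := n) (P := Pf n) μ (Kf n) (αf n)
        (fun ω => (∃ (hx : vx n < n) (hy : vy n < n), ω.1 ⟨vx n, hx⟩ = (⟨0, hr⟩ : Fin r) ∧ deg ω ⟨vx n, hx⟩ = ℓ ∧ ω.1 ⟨vy n, hy⟩ = (⟨0, hr⟩ : Fin r) ∧ deg ω ⟨vy n, hy⟩ = ℓ ∧ ¬ adj ω ⟨vx n, hx⟩ ⟨vy n, hy⟩))) atTop (nhds 0) := by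
  intro ℓ
  obtain ⟨c, hc, hcL⟩ := hΩ
  have : Nonempty (Fin r) := ⟨⟨0, hr⟩⟩
  obtain ⟨j₀, hj₀⟩ := Finite.exists_min μ
  set i : Fin r := ⟨0, hr⟩
  set m := μ j₀
  have hm : 0 < m := hμpos j₀
  set l : ℕ → ℝ := fun n => lam μ (Pf n) (Kf n) i
  set L : ℕ → ℝ := fun n => αf n * l n
  have hl0 : ∀ n, 0 ≤ l n := fun n =>
    Finset.sum_nonneg fun j _ => mul_nonneg (hμpos j).le (pEdge_nonneg _ i j)
  have hL0 : ∀ᶠ n in atTop, 0 ≤ L n := by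
    filter_upwards [eventually_ge_atTop 2] with n hn using mul_nonneg (hα n hn).1.le (hl0 n)
  have hLlog : ∀ᶠ n : ℕ in atTop, n * L n ≤ 6 / 5 * Real.log n := by
    filter_upwards [eventually_ge_atTop 2, eventually_le_log (k := (k : ℝ) - 1) hγ] with n hn h
    have hn0 : (n : ℝ) ≠ 0 := by positivity
    rwa [show L n = _ from hγdef n hn, mul_div_cancel₀ _ hn0]
  have hT := tendsto_mul_exp_log hL0 hLlog
  have hδ : Tendsto (fun n : ℕ =>
      ((4 * (1 / c + 1)) ^ (2 * ℓ) * (ℓ.factorial : ℝ) ^ 2 * Real.exp 3) * (5 / 4) *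
        (Real.exp (5 / 4 * (L n * Real.exp (3 / 4 * Real.log n)) / m) - 1 + l n / m))
      atTop (nhds 0) := by
    have h1 := (Real.continuous_exp.tendsto _).comp ((hT.const_mul (5 / 4)).div_const m)
    have h2 := ((h1.sub_const 1).add (hlam.div_const m)).const_mul
      (((4 * (1 / c + 1)) ^ (2 * ℓ) * (ℓ.factorial : ℝ) ^ 2 * Real.exp 3) * (5 / 4))
    simpa using h2
  refine squeeze_zero' ?_ ?_ hδ
  · filter_upwards [eventually_ge_atTop 2] with n hn
    exact div_nonneg (Pr_nonneg hμpos _ (hα n hn).1 (hα n hn).2 _)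
      (Pr_nonneg hμpos _ (hα n hn).1 (hα n hn).2 _)
  filter_upwards [eventually_ge_atTop (4 * ℓ + 2), hcL, hL0, hLlog,
    hlam.eventually_le_const (show 0 < m / 5 by positivity),
    hT.eventually_le_const (show (0 : ℝ) < 1 / 32 by norm_num),
    hT.eventually_le_const (show 0 < m / 16 by positivity)] with n hn hcn hLn hlogn hln hT1 hT2
  have hn2 : 2 ≤ n := by omega
  obtain ⟨hx, hy, hne⟩ := hv n hn2
  have hKi : 2 ≤ Kf n i := hK2 n hn2
  have hKlast : ∀ j, 2 * Kf n j ≤ Pf n := fun j =>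
    (Nat.mul_le_mul_left 2 (hKmono n hn2 j _ (Fin.le_def.2 (Nat.le_sub_one_of_lt j.2)))).trans
      (hKP n hn2)
  set E := Real.exp (3 / 4 * Real.log n)
  have hu0 : 0 ≤ Real.log n := Real.log_natCast_nonneg n
  have hE1 : 3 / 4 * Real.log n + 1 ≤ E := Real.add_one_le_exp _
  have hLT : L n ≤ L n * E := le_mul_of_one_le_right hLn (by linarith)
  have hLsq : n * L n ^ 2 ≤ 2 * (L n * E) := by nlinarith
  have hLsqm : 2 * (n * L n ^ 2) / m ≤ 1 / 4 := by
    rw [div_le_iff₀ hm]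
    linarith
  have hmain := Pr_adjacent_le_mul (P := Pf n) (K := Kf n) (x := ⟨vx n, hx⟩) (y := ⟨vy n, hy⟩)
    hμpos hμsum (by have := hKlast i; omega) (fun j => by have := hKlast j; omega)
    (hα n hn2).1 (hα n hn2).2 (fun h => hne (congrArg Fin.val h)) i hKi hm hc hj₀
    (by linarith) (L := L n) rfl hcn hlogn (by linarith) (by linarith) (by linarith) hn
  simp only [hx, hy, exists_true_left]
  refine div_le_of_le_mul₀ (Pr_nonneg hμpos _ (hα n hn2).1 (hα n hn2).2 _) ?_ hmain
  have h1 := Real.one_le_exp (show 0 ≤ 5 / 4 * (L n * E) / m by positivity)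
  have h2 : 0 ≤ l n / m := div_nonneg (hl0 n) hm.le
  exact mul_nonneg (by positivity) (by linarith)
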